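/- Let n ∈ ℕ, s ∈ (1,∞)\ℕ, k ∈ {0,…,[s]−1} with s ∈ (1, n+k+1), and let A be a Young function with ∫_0 (t/A(t))^{(s−(k+1))/(n−(s−(k+1)))} dt < ∞. Then there exists a constant c = c(n,s,k) such that |u|_{𝓛^{k,ψ^k_{s,A}}(ℝⁿ)} ≤ c |∇^{[s]}u|_{{s},A,ℝⁿ} for every u ∈ V^{s,A}_{d,k+1}(ℝⁿ); in particular, V^{s,A}_{d,k+1}(ℝⁿ) is continuously embedded into the k-th order Campanato space 𝓛^{k,ψ^k_{s,A}}(ℝⁿ). -/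

import Mathlib

open MeasureTheory Metric Set Filter
open scoped ENNReal Topology

noncomputable section

/-- Euclidean space `ℝⁿ`. -/
abbrev Euc (n : ℕ) := EuclideanSpace ℝ (Fin n)

/-- A Young function: convex, left-continuous, vanishing at `0`,
non-constant on `(0,∞)`, with values in `[0,∞]`. -/
def IsYoung (A : ℝ → ℝ≥0∞) : Prop :=
  A 0 = 0 ∧
  (∀ x y t : ℝ, 0 ≤ x → 0 ≤ y → 0 ≤ t → t ≤ 1 →
      A (t * x + (1 - t) * y) ≤ ENNReal.ofReal t * A x + ENNReal.ofReal (1 - t) * A y) ∧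
  (∀ t : ℝ, 0 < t → ContinuousWithinAt A (Set.Iic t) t) ∧
  (∃ t₁ t₂ : ℝ, 0 < t₁ ∧ 0 < t₂ ∧ A t₁ ≠ A t₂)

/-- The right-continuous generalized inverse of a monotone function `A : [0,∞) → [0,∞]`. -/
def rcInv (A : ℝ → ℝ≥0∞) (v : ℝ≥0∞) : ℝ :=
  sInf {τ : ℝ | 0 ≤ τ ∧ v < A τ}

/-- The Young conjugate `Ã(t) = sup {τ t - A(τ) : τ ≥ 0}`. -/
def youngConj (A : ℝ → ℝ≥0∞) (t : ℝ) : ℝ≥0∞ :=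
  ⨆ (τ : ℝ) (_ : 0 ≤ τ), ENNReal.ofReal (τ * t) - A τ

/-- The functional `J_{σ,A}(v)` for a vector-valued `v`, with the Euclidean norm. -/
def Jfun (n : ℕ) (σ : ℝ) (A : ℝ → ℝ≥0∞) {ι : Type} [Fintype ι]
    (v : Euc n → ι → ℝ) : ℝ≥0∞ :=
  ∫⁻ x : Euc n, ∫⁻ y : Euc n,
    A (Real.sqrt (∑ i, (v x i - v y i) ^ 2) / ‖x - y‖ ^ σ) /
      ENNReal.ofReal (‖x - y‖ ^ (n : ℝ))

/-- The fractional Orlicz–Sobolev seminorm `|v|_{σ,A,ℝⁿ}` (vector-valued version). -/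
def fracSem (n : ℕ) (σ : ℝ) (A : ℝ → ℝ≥0∞) {ι : Type} [Fintype ι]
    (v : Euc n → ι → ℝ) : ℝ≥0∞ :=
  sInf (ENNReal.ofReal '' {lam : ℝ | 0 < lam ∧ Jfun n σ A (fun x i => v x i / lam) ≤ 1})

/-- The fractional Orlicz–Sobolev seminorm `|u|_{σ,A,ℝⁿ}` of a scalar function. -/
def fracSemS (n : ℕ) (σ : ℝ) (A : ℝ → ℝ≥0∞) (u : Euc n → ℝ) : ℝ≥0∞ :=
  fracSem n σ A (fun x (_ : Fin 1) => u x)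

/-- The normalized mean oscillation `φ(|B|^{1/n})⁻¹ ⨍_B |u - u_B|` over the ball `B = B(x,r)`. -/
def oscQuot (n : ℕ) (φ : ℝ → ℝ) (u : Euc n → ℝ) (x : Euc n) (r : ℝ) : ℝ :=
  (φ ((volume (ball x r)).toReal ^ ((n : ℝ)⁻¹)))⁻¹ *
    ⨍ y in ball x r, |u y - ⨍ z in ball x r, u z|

/-- The Campanato seminorm `|u|_{𝓛^φ(ℝⁿ)}`. -/
def campSem (n : ℕ) (φ : ℝ → ℝ) (u : Euc n → ℝ) : ℝ≥0∞ :=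
  ⨆ (x : Euc n) (r : ℝ) (_ : 0 < r), ENNReal.ofReal (oscQuot n φ u x r)

/-- The Campanato quantity restricted to balls of measure at most `r`. -/
def campSemSmall (n : ℕ) (φ : ℝ → ℝ) (u : Euc n → ℝ) (r : ℝ) : ℝ≥0∞ :=
  ⨆ (x : Euc n) (ρ : ℝ) (_ : 0 < ρ) (_ : volume (ball x ρ) ≤ ENNReal.ofReal r),
    ENNReal.ofReal (oscQuot n φ u x ρ)

/-- `φ : (0,∞) → (0,∞)` is admissible: positive and bounded below away from zero on `[a,∞)`. -/
def Admissible (φ : ℝ → ℝ) : Prop :=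
  (∀ r : ℝ, 0 < r → 0 < φ r) ∧
  ∀ a : ℝ, 0 < a → ∃ ε : ℝ, 0 < ε ∧ ∀ r : ℝ, a ≤ r → ε ≤ φ r

/-- `φ_{s,A}(r) = r^s A⁻¹(r^{-n})`. -/
def phiSA (n : ℕ) (s : ℝ) (A : ℝ → ℝ≥0∞) (r : ℝ) : ℝ :=
  r ^ s * rcInv A (ENNReal.ofReal (r ^ (-(n : ℝ))))

/-- `u` is `m`-times weakly differentiable, with iterated weak partial
derivatives recorded by `D`. -/
def HasWeakDerivs (n m : ℕ) (u : Euc n → ℝ)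
    (D : (h : ℕ) → Euc n → (Fin h → Fin n) → ℝ) : Prop :=
  (∀ x d, D 0 x d = u x) ∧
  ∀ h : ℕ, h ≤ m → ∀ dirs : Fin h → Fin n,
    LocallyIntegrable (fun x => D h x dirs) volume ∧
    ∀ φ : Euc n → ℝ, ContDiff ℝ (⊤ : ℕ∞) φ → HasCompactSupport φ →
      ∫ x : Euc n, u x *
          iteratedFDeriv ℝ h φ x (fun i => EuclideanSpace.single (dirs i) (1 : ℝ)) =
        (-1 : ℝ) ^ h * ∫ x : Euc n, D h x dirs * φ x

/-- The Euclidean length `|∇^h u|(x)` of the `h`-th order weak gradient. -/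
def gradLen (n : ℕ) (D : (h : ℕ) → Euc n → (Fin h → Fin n) → ℝ) (h : ℕ) (x : Euc n) : ℝ :=
  Real.sqrt (∑ d : Fin h → Fin n, (D h x d) ^ 2)

/-- The derivatives of orders `k, …, m` decay near infinity:
`|{|∇^h u| > t}| < ∞` for every `t > 0`. -/
def DecayFrom (n k m : ℕ) (D : (h : ℕ) → Euc n → (Fin h → Fin n) → ℝ) : Prop :=
  ∀ h : ℕ, k ≤ h → h ≤ m → ∀ t : ℝ, 0 < t →
    volume {x : Euc n | t < gradLen n D h x} < ⊤

/-- The Young function `F_k(t) = t^{n/(n-s+k+1)} ∫_0^t Ã(τ) τ^{-1-n/(n-s+k+1)} dτ`. -/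
def Fk (n : ℕ) (s : ℝ) (k : ℕ) (A : ℝ → ℝ≥0∞) (t : ℝ) : ℝ≥0∞ :=
  ENNReal.ofReal (t ^ ((n : ℝ) / ((n : ℝ) - s + (k : ℝ) + 1))) *
    ∫⁻ τ in Set.Ioc (0 : ℝ) t,
      youngConj A τ * ENNReal.ofReal (τ ^ (-1 - (n : ℝ) / ((n : ℝ) - s + (k : ℝ) + 1)))

/-- `ψ^k_{s,A}(r) = 1 / (r^{n-s+k} F_k⁻¹(r^{-n}))`. -/
def psiK (n : ℕ) (s : ℝ) (k : ℕ) (A : ℝ → ℝ≥0∞) (r : ℝ) : ℝ :=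
  (r ^ ((n : ℝ) - s + (k : ℝ)) * rcInv (Fk n s k A) (ENNReal.ofReal (r ^ (-(n : ℝ)))))⁻¹

/-- `ψ^{[s]}_{s,A}(r) = r^{{s}} A⁻¹(r^{-n})`. -/
def psiTop (n : ℕ) (s : ℝ) (A : ℝ → ℝ≥0∞) (r : ℝ) : ℝ :=
  r ^ (s - (⌊s⌋₊ : ℝ)) * rcInv A (ENNReal.ofReal (r ^ (-(n : ℝ))))

/-- Convergence near zero of `∫_0 (t/A(t))^{(s-(k+1))/(n-(s-(k+1)))} dt`. -/
def IntCondK (n : ℕ) (s : ℝ) (k : ℕ) (A : ℝ → ℝ≥0∞) : Prop :=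
  ∃ ε : ℝ, 0 < ε ∧
    ∫⁻ t in Set.Ioc (0 : ℝ) ε,
      (ENNReal.ofReal t / A t) ^ ((s - (k : ℝ) - 1) / ((n : ℝ) - (s - (k : ℝ) - 1))) < ⊤

/-- `P` is the projection polynomial `P^k_B[u]`: it has degree at most `k` and its
derivatives up to order `k` match, in the mean over `B`, the weak derivatives `D` of `u`. -/
def IsCampPoly (n k : ℕ) (D : (h : ℕ) → Euc n → (Fin h → Fin n) → ℝ)
    (B : Set (Euc n)) (P : MvPolynomial (Fin n) ℝ) : Prop :=
  P.totalDegree ≤ k ∧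
  ∀ h : ℕ, h ≤ k → ∀ dirs : Fin h → Fin n,
    ∫ x in B, D h x dirs =
      ∫ x in B,
        iteratedFDeriv ℝ h (fun y : Euc n => MvPolynomial.eval (fun i => y i) P) x
          (fun i => EuclideanSpace.single (dirs i) (1 : ℝ))

/-- The normalized oscillation of order `k` over the ball `B(x,r)`. -/
def oscQuotK (n k : ℕ) (φ : ℝ → ℝ) (u : Euc n → ℝ)
    (D : (h : ℕ) → Euc n → (Fin h → Fin n) → ℝ) (x : Euc n) (r : ℝ) : ℝ≥0∞ :=
  ⨅ (P : MvPolynomial (Fin n) ℝ) (_ : IsCampPoly n k D (ball x r) P),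
    ENNReal.ofReal
      ((φ ((volume (ball x r)).toReal ^ ((n : ℝ)⁻¹)) *
          (volume (ball x r)).toReal ^ ((k : ℝ) / (n : ℝ)))⁻¹ *
        ⨍ y in ball x r, |u y - MvPolynomial.eval (fun i => y i) P|)

/-- The `k`-th order Campanato seminorm `|u|_{𝓛^{k,φ}(ℝⁿ)}`. -/
def campSemK (n k : ℕ) (φ : ℝ → ℝ) (u : Euc n → ℝ)
    (D : (h : ℕ) → Euc n → (Fin h → Fin n) → ℝ) : ℝ≥0∞ :=
  ⨆ (x : Euc n) (r : ℝ) (_ : 0 < r), oscQuotK n k φ u D x r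

/-- The `k`-th order Campanato quantity restricted to balls of measure at most `r`. -/
def campSemKSmall (n k : ℕ) (φ : ℝ → ℝ) (u : Euc n → ℝ)
    (D : (h : ℕ) → Euc n → (Fin h → Fin n) → ℝ) (r : ℝ) : ℝ≥0∞ :=
  ⨆ (x : Euc n) (ρ : ℝ) (_ : 0 < ρ) (_ : volume (ball x ρ) ≤ ENNReal.ofReal r),
    oscQuotK n k φ u D x ρ

/-- The Luxemburg norm `‖f‖_{L^A(μ)}`. -/
def luxNorm {α : Type*} [MeasurableSpace α] (A : ℝ → ℝ≥0∞) (μ : Measure α)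
    (f : α → ℝ) : ℝ≥0∞ :=
  sInf (ENNReal.ofReal '' {lam : ℝ | 0 < lam ∧ ∫⁻ x, A (|f x| / lam) ∂μ ≤ 1})

/-- Iterated integral `∫_r^∞ ∫_{r_1}^∞ ⋯ g`. -/
def iterInt : ℕ → (ℝ → ℝ) → (ℝ → ℝ)
  | 0, g => g
  | j + 1, g => fun r => ∫ t in Set.Ioi r, iterInt j g t

end

/-- The mean of `|f|` over a ball. -/
noncomputable def ballAvg {n : ℕ} (f : Euc n → ℝ) (x : Euc n) (r : ℝ) : ℝ≥0∞ :=
  (volume (ball x r))⁻¹ * ∫⁻ y in ball x r, ‖f y‖ₑ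

/-- The mean of `|f y - f z|` over pairs of points of a ball. -/
noncomputable def ballOsc {n : ℕ} (f : Euc n → ℝ) (x : Euc n) (r : ℝ) : ℝ≥0∞ :=
  (volume (ball x r))⁻¹ * ((volume (ball x r))⁻¹ *
    ∫⁻ y in ball x r, ∫⁻ z in ball x r, ‖f y - f z‖ₑ)

lemma volume_ball_euc {n : ℕ} (hn : 0 < n) (x : Euc n) {r : ℝ} (hr : 0 ≤ r) :
    volume (ball x r) = ENNReal.ofReal r ^ n * volume (ball (0 : Euc n) 1) := by
  have : Nonempty (Fin n) := ⟨⟨0, hn⟩⟩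
  rw [Measure.addHaar_ball volume x hr, finrank_euclideanSpace_fin, ENNReal.ofReal_pow hr]

lemma volume_ball_ne_zero {n : ℕ} (x : Euc n) {r : ℝ} (hr : 0 < r) :
    volume (ball x r) ≠ 0 := (measure_ball_pos volume x hr).ne'

lemma volume_ball_ne_top {n : ℕ} (x : Euc n) (r : ℝ) :
    volume (ball x r) ≠ ⊤ := measure_ball_lt_top.ne

lemma measure_mul_lintegral_enorm_le {n : ℕ} {f : Euc n → ℝ} (hf : AEMeasurable f volume)
    {B G T : Set (Euc n)} (hB : B ⊆ T) (hG : G ⊆ T) :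
    volume G * ∫⁻ y in B, ‖f y‖ₑ ≤
      (∫⁻ y in T, ∫⁻ z in T, ‖f y - f z‖ₑ) + volume B * ∫⁻ z in G, ‖f z‖ₑ := by
  calc volume G * ∫⁻ y in B, ‖f y‖ₑ
      = ∫⁻ y in B, ∫⁻ _ in G, ‖f y‖ₑ := by
        simp only [lintegral_const, Measure.restrict_apply_univ]
        rw [lintegral_mul_const'' _ hf.enorm.restrict, mul_comm]
    _ ≤ ∫⁻ y in B, ((∫⁻ z in G, ‖f y - f z‖ₑ) + ∫⁻ z in G, ‖f z‖ₑ) := by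
        refine lintegral_mono fun y => ?_
        rw [← lintegral_add_right' _ hf.enorm.restrict]
        refine lintegral_mono fun z => ?_
        calc ‖f y‖ₑ = ‖(f y - f z) + f z‖ₑ := by simp
          _ ≤ _ := enorm_add_le _ _
    _ = (∫⁻ y in B, ∫⁻ z in G, ‖f y - f z‖ₑ) + volume B * ∫⁻ z in G, ‖f z‖ₑ := by
        rw [lintegral_add_right _ measurable_const]
        simp [mul_comm]
    _ ≤ _ := by
        gcongr

lemma ballAvg_le_double {n : ℕ} (hn : 0 < n) {f : Euc n → ℝ} (hf : AEMeasurable f volume)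
    (x : Euc n) {r : ℝ} (hr : 0 < r) :
    ballAvg f x r ≤ 2 ^ n * ballOsc f x (2 * r) + ballAvg f x (2 * r) := by
  have h := measure_mul_lintegral_enorm_le hf (B := ball x r) (G := ball x (2 * r))
    (T := ball x (2 * r)) (ball_subset_ball (by linarith)) subset_rfl
  have hV : volume (ball x (2 * r)) = 2 ^ n * volume (ball x r) := by
    rw [volume_ball_euc hn x (by positivity), volume_ball_euc hn x hr.le,
      ENNReal.ofReal_mul (by norm_num), mul_pow, mul_assoc]
    norm_num
  have h0 := volume_ball_ne_zero x hr
  have h1 := volume_ball_ne_top x r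
  have h0' := volume_ball_ne_zero x (r := 2 * r) (by positivity)
  have h1' := volume_ball_ne_top x (2 * r)
  unfold ballAvg ballOsc
  set V := volume (ball x r)
  set V' := volume (ball x (2 * r))
  set I := ∫⁻ y in ball x r, ‖f y‖ₑ
  set I' := ∫⁻ y in ball x (2 * r), ‖f y‖ₑ
  set J := ∫⁻ y in ball x (2 * r), ∫⁻ z in ball x (2 * r), ‖f y - f z‖ₑ
  calc V⁻¹ * I = V⁻¹ * V'⁻¹ * (V' * I) := by
        rw [mul_assoc, ← mul_assoc V'⁻¹, ENNReal.inv_mul_cancel h0' h1', one_mul]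
    _ ≤ V⁻¹ * V'⁻¹ * (J + V * I') := by gcongr
    _ = V⁻¹ * (V'⁻¹ * J) + (V⁻¹ * V) * (V'⁻¹ * I') := by ring
    _ = _ := by
        rw [ENNReal.inv_mul_cancel h0 h1, one_mul, ← mul_assoc (2 ^ n)]
        congr 2
        rw [hV, ENNReal.mul_inv (by simp) (by simp), ← mul_assoc,
          ENNReal.mul_inv_cancel (by simp) (by simp), one_mul]

lemma ballAvg_le_of_small {n : ℕ} {f : Euc n → ℝ} (hf : AEMeasurable f volume)
    (x : Euc n) {r t : ℝ} (hr : 0 < r)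
    (hsmall : 2 * volume {y | t < |f y|} ≤ volume (ball x r)) :
    ballAvg f x r ≤ 2 * ballOsc f x r + ENNReal.ofReal t := by
  set N := toMeasurable volume {y | t < |f y|} with hN
  have h := measure_mul_lintegral_enorm_le hf (B := ball x r) (G := ball x r \ N)
    (T := ball x r) subset_rfl sdiff_subset
  have h0 := volume_ball_ne_zero x hr
  have h1 := volume_ball_ne_top x r
  have hG : ∫⁻ z in ball x r \ N, ‖f z‖ₑ ≤ ENNReal.ofReal t * volume (ball x r \ N) := by
    rw [← setLIntegral_const]
    refine setLIntegral_mono' (measurableSet_ball.diff (measurableSet_toMeasurable _ _)) ?_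
    intro z hz
    have : ¬ t < |f z| := fun h => hz.2 (subset_toMeasurable _ _ h)
    rw [Real.enorm_eq_ofReal_abs]
    exact ENNReal.ofReal_le_ofReal (not_lt.1 this)
  have hNv : volume N = volume {y | t < |f y|} := measure_toMeasurable _
  have hVG : volume (ball x r) ≤ 2 * volume (ball x r \ N) := by
    have h2 : volume (ball x r) ≤ volume (ball x r \ N) + volume N := by
      refine (measure_mono ?_).trans (measure_union_le _ _)
      intro z hz
      by_cases hz' : z ∈ N
      · exact Or.inr hz'
      · exact Or.inl ⟨hz, hz'⟩
    have h3 : volume (ball x r) + volume (ball x r) ≤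
        2 * volume (ball x r \ N) + volume (ball x r) := by
      calc volume (ball x r) + volume (ball x r) = 2 * volume (ball x r) := by ring
        _ ≤ 2 * (volume (ball x r \ N) + volume N) := by gcongr
        _ = 2 * volume (ball x r \ N) + 2 * volume N := by ring
        _ ≤ _ := by rw [hNv]; gcongr
    exact (ENNReal.add_le_add_iff_right h1).1 h3
  have hG1 : volume (ball x r \ N) ≠ ⊤ :=
    ((measure_mono sdiff_subset).trans_lt (lt_top_iff_ne_top.2 h1)).ne
  have hG0 : volume (ball x r \ N) ≠ 0 := by
    intro h; rw [h] at hVG; simp at hVG; exact h0 hVG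
  unfold ballAvg ballOsc
  set V := volume (ball x r)
  set W := volume (ball x r \ N)
  set I := ∫⁻ y in ball x r, ‖f y‖ₑ
  set J := ∫⁻ y in ball x r, ∫⁻ z in ball x r, ‖f y - f z‖ₑ
  have hW : W⁻¹ ≤ 2 * V⁻¹ := by
    rw [ENNReal.inv_le_iff_inv_le, ENNReal.mul_inv (by simp) (by simp), inv_inv]
    calc 2⁻¹ * V ≤ 2⁻¹ * (2 * W) := by gcongr
      _ = W := by rw [← mul_assoc, ENNReal.inv_mul_cancel (by simp) (by simp), one_mul]
  calc V⁻¹ * I = V⁻¹ * W⁻¹ * (W * I) := by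
        rw [mul_assoc, ← mul_assoc W⁻¹, ENNReal.inv_mul_cancel hG0 hG1, one_mul]
    _ ≤ V⁻¹ * W⁻¹ * (J + V * (ENNReal.ofReal t * W)) := by
        gcongr; exact h.trans (by gcongr)
    _ = V⁻¹ * (W⁻¹ * J) + (V⁻¹ * V) * (W⁻¹ * W) * ENNReal.ofReal t := by ring
    _ = V⁻¹ * (W⁻¹ * J) + ENNReal.ofReal t := by
        rw [ENNReal.inv_mul_cancel h0 h1, ENNReal.inv_mul_cancel hG0 hG1]; simp
    _ ≤ V⁻¹ * ((2 * V⁻¹) * J) + ENNReal.ofReal t := by gcongr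
    _ = _ := by ring

lemma ballAvg_le_tsum {n : ℕ} (hn : 0 < n) {f : Euc n → ℝ} (hf : AEMeasurable f volume)
    (hd : ∀ t : ℝ, 0 < t → volume {y | t < |f y|} < ⊤) (x : Euc n) {r : ℝ} (hr : 0 < r) :
    ballAvg f x r ≤ (2 ^ n + 2) * ∑' l : ℕ, ballOsc f x (2 ^ l * r) := by
  set S := ∑' l : ℕ, ballOsc f x (2 ^ l * r) with hS
  have hfin : ∀ N : ℕ, ballAvg f x r ≤
      2 ^ n * (∑ l ∈ Finset.range N, ballOsc f x (2 ^ (l + 1) * r)) + ballAvg f x (2 ^ N * r) := by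
    intro N
    induction N with
    | zero => simp
    | succ N ih =>
      have := ballAvg_le_double hn hf x (r := 2 ^ N * r) (by positivity)
      rw [Finset.sum_range_succ, mul_add, add_assoc]
      refine ih.trans ?_
      gcongr
      rwa [← mul_assoc, ← pow_succ'] at this
  refine ENNReal.le_of_forall_pos_le_add fun ε hε _ => ?_
  have hεr : (0 : ℝ) < ε := hε
  obtain ⟨N, hN⟩ : ∃ N : ℕ, 2 * volume {y | (ε : ℝ) < |f y|} ≤ volume (ball x (2 ^ N * r)) := by
    have hlt : 2 * volume {y | (ε : ℝ) < |f y|} / volume (ball x r) < ⊤ :=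
      ENNReal.div_lt_top (ENNReal.mul_ne_top (by simp) (hd ε hεr).ne) (volume_ball_ne_zero x hr)
    obtain ⟨N, hN⟩ := ENNReal.exists_nat_gt hlt.ne
    refine ⟨N, ?_⟩
    have h2 : (N : ℝ≥0∞) * volume (ball x r) ≤ volume (ball x (2 ^ N * r)) := by
      rw [volume_ball_euc hn x (r := 2 ^ N * r) (by positivity), volume_ball_euc hn x hr.le,
        ENNReal.ofReal_mul (by positivity), mul_pow, mul_assoc]
      gcongr
      rw [ENNReal.ofReal_pow (by norm_num)]
      simp only [ENNReal.ofReal_ofNat]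
      calc (N : ℝ≥0∞) ≤ ((2 ^ N : ℕ) : ℝ≥0∞) := by exact_mod_cast Nat.lt_two_pow_self.le
        _ = 2 ^ N := by simp
        _ ≤ (2 ^ N) ^ n := le_self_pow (one_le_pow₀ (by norm_num)) hn.ne'
    refine le_trans ?_ h2
    rw [← ENNReal.div_le_iff (volume_ball_ne_zero x hr) (volume_ball_ne_top x r)]
    exact hN.le
  have h3 := ballAvg_le_of_small hf x (r := 2 ^ N * r) (by positivity) hN
  have h4 : ∑ l ∈ Finset.range N, ballOsc f x (2 ^ (l + 1) * r) ≤ S := by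
    calc _ ≤ ∑ l ∈ Finset.range (N + 1), ballOsc f x (2 ^ l * r) := by
          rw [Finset.sum_range_succ']; exact le_self_add
      _ ≤ S := ENNReal.sum_le_tsum _
  have h5 : ballOsc f x (2 ^ N * r) ≤ S := ENNReal.le_tsum N
  calc ballAvg f x r ≤ 2 ^ n * S + (2 * S + ENNReal.ofReal ε) :=
        (hfin N).trans (add_le_add (by gcongr) (h3.trans (by gcongr)))
    _ = (2 ^ n + 2) * S + ε := by rw [ENNReal.ofReal_coe_nnreal]; ring

lemma lintegral_homothety {n : ℕ} {H : Euc n → ℝ≥0∞} (hH : Measurable H) (c : Euc n) {t : ℝ}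
    (ht : 0 < t) :
    ∫⁻ x, H (t • x + c) = ENNReal.ofReal ((t ^ n)⁻¹) * ∫⁻ x, H x := by
  have h1 : ∫⁻ x, H (t • x + c) = ∫⁻ z, H (z + c) ∂(Measure.map (t • ·) volume) := by
    rw [lintegral_map (by fun_prop) (by fun_prop)]
  rw [h1, Measure.map_addHaar_smul volume ht.ne', finrank_euclideanSpace_fin,
    lintegral_smul_measure, abs_of_pos (by positivity), lintegral_add_right_eq_self H c]
  rfl

lemma setLIntegral_homothety_le {n : ℕ} {G : Euc n → ℝ≥0∞} (hG : Measurable G)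
    {x₀ y : Euc n} {r t : ℝ} (hy : y ∈ ball x₀ r) (ht : 1 / 2 ≤ t) (ht1 : t ≤ 1) :
    ∫⁻ x in ball x₀ r, G (y + t • (x - y)) ≤ 2 ^ n * ∫⁻ x in ball x₀ r, G x := by
  have htpos : 0 < t := by linarith
  calc ∫⁻ x in ball x₀ r, G (y + t • (x - y))
      ≤ ∫⁻ x, (ball x₀ r).indicator G (t • x + (y - t • y)) := by
        rw [← lintegral_indicator measurableSet_ball]
        refine lintegral_mono fun x => ?_
        by_cases hx : x ∈ ball x₀ r
        · have hmem : t • x + (y - t • y) ∈ ball x₀ r := by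
            have := (convex_ball x₀ r) hx hy htpos.le (sub_nonneg.2 ht1) (by ring)
            convert this using 1
            module
          rw [indicator_of_mem hx, indicator_of_mem hmem]
          apply le_of_eq
          congr 1
          module
        · rw [indicator_of_notMem hx]; exact zero_le
    _ = ENNReal.ofReal ((t ^ n)⁻¹) * ∫⁻ x in ball x₀ r, G x := by
        rw [lintegral_homothety (hG.indicator measurableSet_ball) _ htpos,
          lintegral_indicator measurableSet_ball]
    _ ≤ _ := by
        gcongr
        have : (t ^ n)⁻¹ ≤ 2 ^ n := by
          rw [← inv_pow]
          refine pow_le_pow_left₀ (by positivity) ?_ n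
          rw [inv_le_comm₀ htpos (by norm_num)]
          linarith
        calc ENNReal.ofReal ((t ^ n)⁻¹) ≤ ENNReal.ofReal (2 ^ n) := ENNReal.ofReal_le_ofReal this
          _ = 2 ^ n := by rw [ENNReal.ofReal_pow (by norm_num)]; simp

lemma enorm_sub_midpoint_le {n : ℕ} {F : Euc n → ℝ} (hF : ContDiff ℝ 1 F) (x y : Euc n) :
    ‖F x - F (y + (1 / 2 : ℝ) • (x - y))‖ₑ ≤
      ∫⁻ t in Ioc (1 / 2 : ℝ) 1, ‖fderiv ℝ F (y + t • (x - y))‖ₑ * ‖x - y‖ₑ := by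
  have hd : ∀ t : ℝ, HasDerivAt (fun t : ℝ => F (y + t • (x - y)))
      (fderiv ℝ F (y + t • (x - y)) (x - y)) t := by
    intro t
    have h1 : HasDerivAt (fun t : ℝ => y + t • (x - y)) (x - y) t := by
      simpa using ((hasDerivAt_id t).smul_const (x - y)).const_add y
    exact ((hF.differentiable (by norm_num) _).hasFDerivAt).comp_hasDerivAt t h1
  have hc : Continuous fun t : ℝ => fderiv ℝ F (y + t • (x - y)) (x - y) := by
    have := hF.continuous_fderiv (by norm_num)
    fun_prop
  have h := intervalIntegral.integral_eq_sub_of_hasDerivAt (a := (1 / 2 : ℝ)) (b := 1)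
    (fun t _ => hd t) (hc.intervalIntegrable _ _)
  have h2 : F (y + (1 : ℝ) • (x - y)) = F x := by congr 1; module
  rw [h2] at h
  rw [← h, intervalIntegral.integral_of_le (by norm_num)]
  refine (enorm_integral_le_lintegral_enorm _).trans (lintegral_mono fun t => ?_)
  exact ContinuousLinearMap.le_opENorm _ _

lemma lintegral_sub_midpoint_le {n : ℕ} {F : Euc n → ℝ} (hF : ContDiff ℝ 1 F) {x₀ y : Euc n}
    {r : ℝ} (hy : y ∈ ball x₀ r) :
    ∫⁻ x in ball x₀ r, ‖F x - F (y + (1 / 2 : ℝ) • (x - y))‖ₑ ≤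
      ENNReal.ofReal (2 * r) * (2 ^ n * ∫⁻ x in ball x₀ r, ‖fderiv ℝ F x‖ₑ) := by
  have hcf : Continuous (fderiv ℝ F) := hF.continuous_fderiv (by norm_num)
  have hG : Measurable fun x => ‖fderiv ℝ F x‖ₑ := hcf.enorm.measurable
  calc ∫⁻ x in ball x₀ r, ‖F x - F (y + (1 / 2 : ℝ) • (x - y))‖ₑ
      ≤ ∫⁻ x in ball x₀ r, ∫⁻ t in Ioc (1 / 2 : ℝ) 1,
          ENNReal.ofReal (2 * r) * ‖fderiv ℝ F (y + t • (x - y))‖ₑ := by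
        refine setLIntegral_mono' measurableSet_ball fun x hx => ?_
        refine (enorm_sub_midpoint_le hF x y).trans (lintegral_mono fun t => ?_)
        rw [mul_comm]
        gcongr
        rw [← ofReal_norm]
        refine ENNReal.ofReal_le_ofReal ?_
        rw [← dist_eq_norm]
        have h1 := mem_ball.1 hx
        have h2 := mem_ball'.1 hy
        linarith [dist_triangle x x₀ y]
    _ = ENNReal.ofReal (2 * r) * ∫⁻ t in Ioc (1 / 2 : ℝ) 1, ∫⁻ x in ball x₀ r,
          ‖fderiv ℝ F (y + t • (x - y))‖ₑ := by
        rw [lintegral_lintegral_swap]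
        · rw [← lintegral_const_mul' _ _ ENNReal.ofReal_ne_top]
          refine lintegral_congr fun t => ?_
          rw [lintegral_const_mul' _ _ ENNReal.ofReal_ne_top]
        · apply Measurable.aemeasurable
          apply Measurable.const_mul
          apply Continuous.measurable
          apply Continuous.enorm
          fun_prop
    _ ≤ ENNReal.ofReal (2 * r) * ∫⁻ t in Ioc (1 / 2 : ℝ) 1,
          2 ^ n * ∫⁻ x in ball x₀ r, ‖fderiv ℝ F x‖ₑ := by
        gcongr 1
        refine setLIntegral_mono' measurableSet_Ioc fun t ht => ?_
        exact setLIntegral_homothety_le hG hy ht.1.le ht.2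
    _ ≤ _ := by
        gcongr 1
        rw [setLIntegral_const, Real.volume_Ioc]
        calc _ ≤ (2 ^ n * ∫⁻ x in ball x₀ r, ‖fderiv ℝ F x‖ₑ) * ENNReal.ofReal 1 := by
              gcongr; norm_num
          _ = _ := by simp

lemma enorm_fderiv_le_sum {n : ℕ} (L : Euc n →L[ℝ] ℝ) :
    ‖L‖ₑ ≤ ∑ i, ‖L (EuclideanSpace.single i (1 : ℝ))‖ₑ := by
  have h : ‖L‖ ≤ ∑ i, ‖L (EuclideanSpace.single i (1 : ℝ))‖ := by
    refine ContinuousLinearMap.opNorm_le_bound _ (Finset.sum_nonneg fun _ _ => norm_nonneg _) ?_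
    intro w
    have hw : w = ∑ i, w i • EuclideanSpace.single i (1 : ℝ) := by
      have := (EuclideanSpace.basisFun (Fin n) ℝ).sum_repr w
      simpa using this.symm
    conv_lhs => rw [hw]
    rw [map_sum, Finset.sum_mul]
    refine (norm_sum_le _ _).trans (Finset.sum_le_sum fun i _ => ?_)
    rw [map_smul, norm_smul, mul_comm]
    gcongr
    exact PiLp.norm_apply_le w i
  rw [← ofReal_norm]
  refine (ENNReal.ofReal_le_ofReal h).trans ?_
  rw [ENNReal.ofReal_sum_of_nonneg (fun _ _ => norm_nonneg _)]
  simp only [ofReal_norm, le_refl]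

lemma poincare_smooth {n : ℕ} {F : Euc n → ℝ} (hF : ContDiff ℝ 1 F) (x₀ : Euc n) (r : ℝ) :
    ∫⁻ y in ball x₀ r, ∫⁻ z in ball x₀ r, ‖F y - F z‖ₑ ≤
      2 ^ (n + 2) * ENNReal.ofReal r * volume (ball x₀ r) *
        ∑ i, ∫⁻ x in ball x₀ r, ‖fderiv ℝ F x (EuclideanSpace.single i (1 : ℝ))‖ₑ := by
  have hc := hF.continuous
  set B := ball x₀ r
  set m : Euc n → Euc n → Euc n := fun x y => y + (1 / 2 : ℝ) • (x - y) with hm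
  have hsymm : ∀ x y, m x y = m y x := by intro x y; simp only [hm]; module
  have hcm : Continuous fun p : Euc n × Euc n => F p.1 - F (m p.1 p.2) := by
    simp only [hm]; fun_prop
  have hcf : Continuous (fderiv ℝ F) := hF.continuous_fderiv (by norm_num)
  set K := ENNReal.ofReal (2 * r) * (2 ^ n * ∫⁻ x in B, ‖fderiv ℝ F x‖ₑ) with hK
  have hhalf : ∫⁻ y in B, ∫⁻ z in B, ‖F z - F (m z y)‖ₑ ≤ K * volume B := by
    rw [← setLIntegral_const]
    exact setLIntegral_mono' measurableSet_ball fun y hy => lintegral_sub_midpoint_le hF hy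
  have hmeas : Measurable fun p : Euc n × Euc n => ‖F p.1 - F (m p.1 p.2)‖ₑ :=
    hcm.enorm.measurable
  calc ∫⁻ y in B, ∫⁻ z in B, ‖F y - F z‖ₑ
      ≤ ∫⁻ y in B, ((∫⁻ z in B, ‖F y - F (m y z)‖ₑ) + ∫⁻ z in B, ‖F z - F (m z y)‖ₑ) := by
        refine lintegral_mono fun y => ?_
        have hy : Measurable fun z => ‖F z - F (m z y)‖ₑ :=
          hmeas.comp (by fun_prop : Measurable fun z : Euc n => (z, y))
        rw [← lintegral_add_right _ hy]
        refine lintegral_mono fun z => ?_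
        calc ‖F y - F z‖ₑ = ‖(F y - F (m y z)) - (F z - F (m z y))‖ₑ := by
              rw [hsymm z y]; congr 1; ring
          _ ≤ _ := enorm_sub_le
    _ = (∫⁻ y in B, ∫⁻ z in B, ‖F y - F (m y z)‖ₑ) +
          ∫⁻ y in B, ∫⁻ z in B, ‖F z - F (m z y)‖ₑ := by
        rw [lintegral_add_left]
        exact hmeas.lintegral_prod_right'
    _ = (∫⁻ y in B, ∫⁻ z in B, ‖F z - F (m z y)‖ₑ) +
          ∫⁻ y in B, ∫⁻ z in B, ‖F z - F (m z y)‖ₑ := by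
        congr 1
        rw [lintegral_lintegral_swap]
        exact hmeas.aemeasurable
    _ ≤ K * volume B + K * volume B := add_le_add hhalf hhalf
    _ = 2 ^ (n + 2) * ENNReal.ofReal r * volume B * ∫⁻ x in B, ‖fderiv ℝ F x‖ₑ := by
        rw [hK, ENNReal.ofReal_mul (by norm_num), ENNReal.ofReal_ofNat, pow_add]
        ring
    _ ≤ _ := by
        gcongr
        rw [← lintegral_finsetSum _ fun i _ => ?_]
        · exact lintegral_mono fun x => enorm_fderiv_le_sum _
        · exact (by fun_prop : Continuous fun x => fderiv ℝ F x
            (EuclideanSpace.single i (1 : ℝ))).enorm.measurable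

lemma exists_translation_lintegral_le {n : ℕ} {g : Euc n → ℝ} (hg : LocallyIntegrable g volume)
    (x₀ : Euc n) (r : ℝ) {ε : ℝ≥0∞} (hε : ε ≠ 0) :
    ∃ δ > 0, ∀ y : Euc n, ‖y‖ < δ → ∫⁻ x in ball x₀ r, ‖g (x - y) - g x‖ₑ ≤ ε := by
  set g' : Euc n → ℝ := (closedBall x₀ (r + 1)).indicator g with hg'
  have hint : Integrable g' volume :=
    (hg.integrableOn_isCompact (isCompact_closedBall x₀ (r + 1))).integrable_indicator
      measurableSet_closedBall
  have hε3 : ε / 3 ≠ 0 := ENNReal.div_ne_zero.2 ⟨hε, by simp⟩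
  obtain ⟨w, hwc, hw, hwcont, -⟩ :=
    (memLp_one_iff_integrable.2 hint).exists_hasCompactSupport_eLpNorm_sub_le
      (by simp) hε3
  rw [eLpNorm_one_eq_lintegral_enorm] at hw
  have huc : UniformContinuous w := hwc.uniformContinuous_of_continuous hwcont
  obtain ⟨η, hη, hηV⟩ : ∃ η : ℝ, 0 < η ∧ ENNReal.ofReal η * volume (ball x₀ r) ≤ ε / 3 := by
    by_cases h : ε / 3 = ⊤
    · exact ⟨1, one_pos, by rw [h]; exact le_top⟩
    · refine ⟨(ε / 3).toReal / ((volume (ball x₀ r)).toReal + 1), ?_, ?_⟩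
      · have := ENNReal.toReal_pos hε3 h
        positivity
      · rw [← ENNReal.ofReal_toReal (volume_ball_ne_top x₀ r), ← ENNReal.ofReal_mul
          (by positivity)]
        conv_rhs => rw [← ENNReal.ofReal_toReal h]
        refine ENNReal.ofReal_le_ofReal ?_
        rw [ENNReal.toReal_ofReal (by positivity), div_mul_eq_mul_div,
          div_le_iff₀ (by positivity)]
        have := ENNReal.toReal_nonneg (a := ε / 3)
        nlinarith
  obtain ⟨δ, hδ, hδw⟩ := Metric.uniformContinuous_iff.1 huc η hη
  refine ⟨min δ 1, by positivity, fun y hy => ?_⟩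
  have hmeas : AEMeasurable (fun x => ‖g' x - w x‖ₑ) volume :=
    (hint.aestronglyMeasurable.aemeasurable.sub hwcont.measurable.aemeasurable).enorm
  have hmeas' : AEMeasurable (fun x => ‖g' (x - y) - w (x - y)‖ₑ) volume :=
    hmeas.comp_quasiMeasurePreserving
      (measurePreserving_sub_right volume y).quasiMeasurePreserving
  calc ∫⁻ x in ball x₀ r, ‖g (x - y) - g x‖ₑ
      ≤ ∫⁻ x in ball x₀ r, (‖g' (x - y) - w (x - y)‖ₑ + (‖g' x - w x‖ₑ + ENNReal.ofReal η)) := by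
        refine setLIntegral_mono_ae' measurableSet_ball (ae_of_all _ fun x hx => ?_)
        have h1 : g' x = g x := indicator_of_mem
          (ball_subset_closedBall (ball_subset_ball (by linarith) hx)) _
        have h2 : g' (x - y) = g (x - y) := by
          refine indicator_of_mem ?_ _
          rw [mem_closedBall, dist_eq_norm]
          rw [mem_ball, dist_eq_norm] at hx
          calc ‖x - y - x₀‖ = ‖(x - x₀) - y‖ := by congr 1; abel
            _ ≤ ‖x - x₀‖ + ‖y‖ := norm_sub_le _ _
            _ ≤ r + 1 := by linarith [hy.trans_le (min_le_right δ 1)]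
        have h3 : ‖w (x - y) - w x‖ₑ ≤ ENNReal.ofReal η := by
          rw [← ofReal_norm]
          refine ENNReal.ofReal_le_ofReal ?_
          rw [← dist_eq_norm]
          refine (hδw ?_).le
          rw [dist_eq_norm]
          simpa using hy.trans_le (min_le_left δ 1)
        rw [← h1, ← h2]
        calc ‖g' (x - y) - g' x‖ₑ
            = ‖(g' (x - y) - w (x - y)) + ((w (x - y) - w x) - (g' x - w x))‖ₑ := by
              congr 1; ring
          _ ≤ ‖g' (x - y) - w (x - y)‖ₑ + (‖w (x - y) - w x‖ₑ + ‖g' x - w x‖ₑ) :=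
              (enorm_add_le _ _).trans (add_le_add le_rfl enorm_sub_le)
          _ ≤ _ := by rw [add_comm ‖w (x - y) - w x‖ₑ]; gcongr
    _ = (∫⁻ x in ball x₀ r, ‖g' (x - y) - w (x - y)‖ₑ) + ((∫⁻ x in ball x₀ r, ‖g' x - w x‖ₑ) +
          ENNReal.ofReal η * volume (ball x₀ r)) := by
        rw [lintegral_add_left' hmeas'.restrict, lintegral_add_left' hmeas.restrict,
          setLIntegral_const]
    _ ≤ (∫⁻ x, ‖g' (x - y) - w (x - y)‖ₑ) + ((∫⁻ x, ‖g' x - w x‖ₑ) +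
          ENNReal.ofReal η * volume (ball x₀ r)) := by
        gcongr <;> exact Measure.restrict_le_self
    _ ≤ ε / 3 + (ε / 3 + ε / 3) := by
        rw [lintegral_sub_right_eq_self (fun x => ‖g' x - w x‖ₑ) y]
        gcongr
        · exact hw
        · exact hw
    _ = ε := by rw [← add_assoc, ENNReal.add_thirds]

/-- A sequence of bump functions shrinking to the origin. -/
noncomputable def shrinkingBump (n : ℕ) (i : ℕ) : ContDiffBump (0 : Euc n) where
  rIn := 1 / ((i : ℝ) + 1) / 2
  rOut := 1 / ((i : ℝ) + 1)
  rIn_pos := by positivity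
  rIn_lt_rOut := half_lt_self (by positivity)

/-- The convolution of `g` with a shrinking normalized bump function. -/
noncomputable def mollify {n : ℕ} (g : Euc n → ℝ) (i : ℕ) (x : Euc n) : ℝ :=
  ∫ t, (shrinkingBump n i).normed volume t * g (x - t)

lemma enorm_mollify_sub_le {n : ℕ} {g : Euc n → ℝ} (hg : LocallyIntegrable g volume) (i : ℕ)
    (x : Euc n) :
    ‖mollify g i x - g x‖ₑ ≤
      ∫⁻ t, ‖(shrinkingBump n i).normed volume t‖ₑ * ‖g (x - t) - g x‖ₑ := by
  set φ := (shrinkingBump n i).normed volume with hφ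
  have h1 : Integrable (fun t => φ t * g (x - t)) volume := by
    have := (shrinkingBump n i).hasCompactSupport_normed (μ := volume)
      |>.convolutionExists_left (ContinuousLinearMap.lsmul ℝ ℝ)
        (shrinkingBump n i).continuous_normed hg x
    simpa [ConvolutionExistsAt] using this
  have h2 : Integrable (fun t => φ t * g x) volume :=
    (shrinkingBump n i).integrable_normed.mul_const _
  have h3 : mollify g i x - g x = ∫ t, φ t * (g (x - t) - g x) := by
    simp only [mul_sub]
    rw [integral_sub h1 h2, integral_mul_const, (shrinkingBump n i).integral_normed, one_mul]
    rfl
  rw [h3]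
  refine (enorm_integral_le_lintegral_enorm _).trans (le_of_eq ?_)
  simp only [enorm_mul]

lemma tendsto_mollify {n : ℕ} {g : Euc n → ℝ} (hg : LocallyIntegrable g volume)
    (x₀ : Euc n) (r : ℝ) :
    Tendsto (fun i => ∫⁻ x in ball x₀ r, ‖mollify g i x - g x‖ₑ) atTop (𝓝 0) := by
  rw [ENNReal.tendsto_nhds_zero]
  intro ε hε
  obtain ⟨δ, hδ, h⟩ := exists_translation_lintegral_le hg x₀ r hε.ne'
  have hlim : Tendsto (fun i : ℕ => 1 / ((i : ℝ) + 1)) atTop (𝓝 0) :=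
    tendsto_one_div_add_atTop_nhds_zero_nat
  filter_upwards [hlim.eventually (gt_mem_nhds hδ)] with i hi
  set φ := (shrinkingBump n i).normed volume with hφ
  have hφm : Measurable φ := (shrinkingBump n i).continuous_normed.measurable
  have hgm : AEMeasurable g volume := hg.aestronglyMeasurable.aemeasurable
  have hφ1 : ∫⁻ t, ‖φ t‖ₑ = 1 := by
    rw [← ofReal_integral_norm_eq_lintegral_enorm (shrinkingBump n i).integrable_normed]
    have : ∫ t, ‖φ t‖ = ∫ t, φ t := by
      congr 1; ext t
      exact Real.norm_of_nonneg ((shrinkingBump n i).nonneg_normed t)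
    rw [this, (shrinkingBump n i).integral_normed, ENNReal.ofReal_one]
  calc ∫⁻ x in ball x₀ r, ‖mollify g i x - g x‖ₑ
      ≤ ∫⁻ x in ball x₀ r, ∫⁻ t, ‖φ t‖ₑ * ‖g (x - t) - g x‖ₑ :=
        lintegral_mono fun x => enorm_mollify_sub_le hg i x
    _ = ∫⁻ t, ∫⁻ x in ball x₀ r, ‖φ t‖ₑ * ‖g (x - t) - g x‖ₑ := by
        rw [lintegral_lintegral_swap]
        have h1 : AEMeasurable (fun p : Euc n × Euc n => g (p.1 - p.2))
            ((volume.restrict (ball x₀ r)).prod volume) :=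
          (hgm.comp_quasiMeasurePreserving (quasiMeasurePreserving_sub volume volume)).mono_ac
            (Measure.AbsolutelyContinuous.prod Measure.restrict_le_self.absolutelyContinuous
              Measure.AbsolutelyContinuous.rfl)
        have h2 : AEMeasurable (fun p : Euc n × Euc n => g p.1)
            ((volume.restrict (ball x₀ r)).prod volume) :=
          hgm.restrict.comp_quasiMeasurePreserving Measure.quasiMeasurePreserving_fst
        exact ((hφm.comp measurable_snd).enorm.aemeasurable.mul (h1.sub h2).enorm)
    _ ≤ ∫⁻ t, ‖φ t‖ₑ * ε := by
        refine lintegral_mono fun t => ?_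
        simp only
        rw [lintegral_const_mul' _ _ enorm_ne_top]
        by_cases ht : ‖t‖ < δ
        · gcongr
          exact h t ht
        · have : φ t = 0 := by
            by_contra hne
            have hmem : t ∈ Function.support φ := hne
            rw [hφ, (shrinkingBump n i).support_normed_eq, mem_ball_zero_iff] at hmem
            exact ht (hmem.trans hi)
          rw [this]; simp
    _ = ε := by rw [lintegral_mul_const _ hφm.enorm, hφ1, one_mul]

section IteratedDerivatives

variable {E : Type*} [NormedAddCommGroup E] [NormedSpace ℝ E]

lemma ContDiff.iteratedFDeriv_apply_const {f : E → ℝ} (hf : ContDiff ℝ (⊤ : ℕ∞) f) (h : ℕ)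
    (w : Fin h → E) : ContDiff ℝ (⊤ : ℕ∞) fun y => iteratedFDeriv ℝ h f y w := by
  have h1 : ContDiff ℝ (⊤ : ℕ∞) (iteratedFDeriv ℝ h f) :=
    hf.iteratedFDeriv_right (by norm_cast)
  exact (ContinuousMultilinearMap.apply ℝ (fun _ : Fin h => E) ℝ w).contDiff.comp h1

lemma ContDiff.iteratedFDeriv_succ_eq_fderiv {f : E → ℝ} (hf : ContDiff ℝ (⊤ : ℕ∞) f) (h : ℕ)
    (x : E) (w : Fin (h + 1) → E) :
    iteratedFDeriv ℝ (h + 1) f x w =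
      fderiv ℝ (fun y => iteratedFDeriv ℝ h f y (Fin.tail w)) x (w 0) := by
  have h1 : ContDiff ℝ (⊤ : ℕ∞) (iteratedFDeriv ℝ h f) :=
    hf.iteratedFDeriv_right (by norm_cast)
  exact ((h1.differentiable (by simp)) x).iteratedFDeriv_succ_apply_left'

lemma ContDiff.fderiv_fderiv_comm {f : E → ℝ} (hf : ContDiff ℝ (⊤ : ℕ∞) f) (x a b : E) :
    fderiv ℝ (fun y => fderiv ℝ f y a) x b = fderiv ℝ (fun y => fderiv ℝ f y b) x a := by
  have hs : IsSymmSndFDerivAt ℝ f x :=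
    (hf.contDiffAt (x := x)).isSymmSndFDerivAt (by simp; exact WithTop.coe_le_coe.2 le_top)
  have hd : DifferentiableAt ℝ (fderiv ℝ f) x :=
    ((hf.fderiv_right (m := (⊤ : ℕ∞)) (by norm_cast)).differentiable (by simp)) x
  have key : ∀ c : E, fderiv ℝ (fun y => fderiv ℝ f y c) x = (fderiv ℝ (fderiv ℝ f) x).flip c := by
    intro c
    rw [fderiv_clm_apply hd (by fun_prop)]
    ext v; simp
  rw [key, key]
  exact hs.eq b a

lemma ContDiff.iteratedFDeriv_comp_adjacent_swap {h : ℕ} {f : E → ℝ}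
    (hf : ContDiff ℝ (⊤ : ℕ∞) f) (i : Fin h) (x : E) (w : Fin (h + 1) → E) :
    iteratedFDeriv ℝ (h + 1) f x (w ∘ Equiv.swap i.castSucc i.succ) =
      iteratedFDeriv ℝ (h + 1) f x w := by
  induction h generalizing x with
  | zero => exact i.elim0
  | succ h ih =>
    rw [hf.iteratedFDeriv_succ_eq_fderiv, hf.iteratedFDeriv_succ_eq_fderiv (h + 1) x w]
    induction i using Fin.cases with
    | zero =>
      simp only [hf.iteratedFDeriv_succ_eq_fderiv h]
      have h0 : (w ∘ Equiv.swap (Fin.castSucc (0 : Fin (h + 1))) (Fin.succ 0)) 0 = w 1 := by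
        simp
      have h1 : Fin.tail (w ∘ Equiv.swap (Fin.castSucc (0 : Fin (h + 1))) (Fin.succ 0)) 0 = w 0 := by
        simp [Fin.tail]
      have h2 : Fin.tail (Fin.tail (w ∘ Equiv.swap (Fin.castSucc (0 : Fin (h + 1))) (Fin.succ 0)))
          = Fin.tail (Fin.tail w) := by
        ext j
        simp only [Fin.tail, Function.comp]
        rw [Equiv.swap_apply_of_ne_of_ne]
        · simp [Fin.ext_iff]
        · simp [Fin.ext_iff]
      rw [h0, h1, h2]
      exact (hf.iteratedFDeriv_apply_const h _).fderiv_fderiv_comm x _ _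
    | succ j =>
      have h0 : (w ∘ Equiv.swap (Fin.castSucc j.succ) (Fin.succ j.succ)) 0 = w 0 := by
        simp only [Function.comp]
        rw [Equiv.swap_apply_of_ne_of_ne]
        · simp [Fin.ext_iff]
        · simp [Fin.ext_iff]
      have h1 : Fin.tail (w ∘ Equiv.swap (Fin.castSucc j.succ) (Fin.succ j.succ)) =
          Fin.tail w ∘ Equiv.swap j.castSucc j.succ := by
        ext l
        simp only [Fin.tail, Function.comp]
        congr 1
        rw [← Fin.succ_castSucc]
        simp only [Equiv.swap_apply_def, Fin.succ_inj]
        split_ifs <;> rfl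
      rw [h0, h1]
      simp only [ih]

/-- Iterated derivatives of a smooth function are symmetric. -/
lemma ContDiff.iteratedFDeriv_comp_perm_of_smooth {h : ℕ} {f : E → ℝ}
    (hf : ContDiff ℝ (⊤ : ℕ∞) f) (σ : Equiv.Perm (Fin h)) (x : E) (w : Fin h → E) :
    iteratedFDeriv ℝ h f x (w ∘ σ) = iteratedFDeriv ℝ h f x w := by
  cases h with
  | zero => congr 1; ext i; exact i.elim0
  | succ h =>
    have hσ : σ ∈ Submonoid.closure
        (Set.range fun i : Fin h => Equiv.swap i.castSucc i.succ) := by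
      rw [Equiv.Perm.mclosure_swap_castSucc_succ]; trivial
    induction hσ using Submonoid.closure_induction generalizing w with
    | mem σ hσ => obtain ⟨i, rfl⟩ := hσ; exact hf.iteratedFDeriv_comp_adjacent_swap i x w
    | one => rfl
    | mul σ τ _ _ h1 h2 =>
      have : w ∘ (σ * τ : Equiv.Perm (Fin (h + 1))) = (w ∘ σ) ∘ τ := rfl
      rw [this, h2, h1]

lemma ContDiff.iteratedFDeriv_comp_const_sub {f : E → ℝ} (hf : ContDiff ℝ (⊤ : ℕ∞) f) (h : ℕ)
    (x y : E) (w : Fin h → E) :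
    iteratedFDeriv ℝ h (fun z => f (x - z)) y w = (-1) ^ h * iteratedFDeriv ℝ h f (x - y) w := by
  have hf' : ContDiff ℝ (⊤ : ℕ∞) fun z => f (x - z) := hf.comp (by fun_prop)
  induction h generalizing y with
  | zero => simp
  | succ h ih =>
    rw [hf'.iteratedFDeriv_succ_eq_fderiv, hf.iteratedFDeriv_succ_eq_fderiv]
    simp only [ih]
    set g := fun z => iteratedFDeriv ℝ h f z (Fin.tail w)
    have hg : DifferentiableAt ℝ g (x - y) :=
      ((hf.iteratedFDeriv_apply_const h _).differentiable (by simp)) _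
    have h1 : HasFDerivAt (fun z => x - z) (-ContinuousLinearMap.id ℝ E) y :=
      (hasFDerivAt_id y).const_sub x
    have h2 := (hg.hasFDerivAt.comp y h1).const_mul ((-1 : ℝ) ^ h)
    have h3 := h2.fderiv
    simp only [Function.comp_def] at h3
    change fderiv ℝ (fun z => (-1 : ℝ) ^ h * g (x - z)) y (w 0) = _
    rw [h3]
    simp [pow_succ]

end IteratedDerivatives

lemma convolution_real_apply {n : ℕ} (f g : Euc n → ℝ) (x : Euc n) :
    convolution f g (ContinuousLinearMap.lsmul ℝ ℝ) volume x = ∫ t, f t * g (x - t) := by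
  simp [convolution_def]

lemma hasCompactSupport_iteratedFDeriv_apply {n : ℕ} {φ : Euc n → ℝ} (hc : HasCompactSupport φ)
    (h : ℕ) (w : Fin h → Euc n) : HasCompactSupport fun y => iteratedFDeriv ℝ h φ y w := by
  have := hc.iteratedFDeriv (𝕜 := ℝ) h
  exact this.comp_left (g := fun L : ContinuousMultilinearMap ℝ (fun _ : Fin h => Euc n) ℝ => L w)
    rfl

lemma fderiv_convolution_apply {n : ℕ} {φ g : Euc n → ℝ} (hφ : ContDiff ℝ (⊤ : ℕ∞) φ)
    (hc : HasCompactSupport φ) (hg : LocallyIntegrable g volume) (x v : Euc n) :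
    fderiv ℝ (fun x => ∫ t, φ t * g (x - t)) x v = ∫ t, fderiv ℝ φ t v * g (x - t) := by
  have h1 := hc.hasFDerivAt_convolution_left (ContinuousLinearMap.lsmul ℝ ℝ)
    (hφ.of_le (by simp)) hg x
  have h2 : (fun x => ∫ t, φ t * g (x - t)) =
      convolution φ g (ContinuousLinearMap.lsmul ℝ ℝ) volume := by
    ext x; rw [convolution_real_apply]
  rw [h2, h1.fderiv, convolution_def]
  have hint : Integrable (fun t => ((ContinuousLinearMap.lsmul ℝ ℝ).precompL (Euc n))
      (fderiv ℝ φ t) (g (x - t))) volume :=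
    (hc.fderiv (𝕜 := ℝ)).convolutionExists_left
      ((ContinuousLinearMap.lsmul ℝ ℝ : ℝ →L[ℝ] ℝ →L[ℝ] ℝ).precompL (Euc n))
      (hφ.continuous_fderiv (by simp)) hg x
  rw [ContinuousLinearMap.integral_apply hint]
  simp

lemma contDiff_convolution {n : ℕ} {φ g : Euc n → ℝ} (hφ : ContDiff ℝ (⊤ : ℕ∞) φ)
    (hc : HasCompactSupport φ) (hg : LocallyIntegrable g volume) :
    ContDiff ℝ (⊤ : ℕ∞) fun x => ∫ t, φ t * g (x - t) := by
  have h2 : (fun x => ∫ t, φ t * g (x - t)) =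
      convolution φ g (ContinuousLinearMap.lsmul ℝ ℝ) volume := by
    ext x; rw [convolution_real_apply]
  rw [h2]
  exact hc.contDiff_convolution_left _ hφ hg

lemma iteratedFDeriv_convolution_apply {n : ℕ} {φ g : Euc n → ℝ} (hφ : ContDiff ℝ (⊤ : ℕ∞) φ)
    (hc : HasCompactSupport φ) (hg : LocallyIntegrable g volume) (h : ℕ) (x : Euc n)
    (w : Fin h → Euc n) :
    iteratedFDeriv ℝ h (fun x => ∫ t, φ t * g (x - t)) x w =
      ∫ t, iteratedFDeriv ℝ h φ t w * g (x - t) := by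
  induction h generalizing x with
  | zero => simp
  | succ h ih =>
    rw [(contDiff_convolution hφ hc hg).iteratedFDeriv_succ_eq_fderiv]
    simp only [ih]
    rw [fderiv_convolution_apply (hφ.iteratedFDeriv_apply_const h _)
      (hasCompactSupport_iteratedFDeriv_apply hc h _) hg]
    simp only [hφ.iteratedFDeriv_succ_eq_fderiv]

lemma contDiff_mollify {n : ℕ} {g : Euc n → ℝ} (hg : LocallyIntegrable g volume) (i : ℕ) :
    ContDiff ℝ (⊤ : ℕ∞) (mollify g i) :=
  contDiff_convolution (shrinkingBump n i).contDiff_normed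
    (shrinkingBump n i).hasCompactSupport_normed hg

lemma HasWeakDerivs.locallyIntegrable {n m : ℕ} {u : Euc n → ℝ}
    {D : (h : ℕ) → Euc n → (Fin h → Fin n) → ℝ} (hu : HasWeakDerivs n m u D) :
    LocallyIntegrable u volume := by
  have := (hu.2 0 (Nat.zero_le _) Fin.elim0).1
  simpa only [hu.1] using this

lemma HasWeakDerivs.iteratedFDeriv_mollify {n m : ℕ} {u : Euc n → ℝ}
    {D : (h : ℕ) → Euc n → (Fin h → Fin n) → ℝ} (hu : HasWeakDerivs n m u D) {h : ℕ}
    (hm : h ≤ m) (dirs : Fin h → Fin n) (i : ℕ) (x : Euc n) :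
    iteratedFDeriv ℝ h (mollify u i) x (fun j => EuclideanSpace.single (dirs j) (1 : ℝ)) =
      mollify (fun x => D h x dirs) i x := by
  set φ := (shrinkingBump n i).normed volume with hφdef
  have hφ : ContDiff ℝ (⊤ : ℕ∞) φ := (shrinkingBump n i).contDiff_normed
  have hc : HasCompactSupport φ := (shrinkingBump n i).hasCompactSupport_normed
  set w : Fin h → Euc n := fun j => EuclideanSpace.single (dirs j) (1 : ℝ) with hw
  have h1 : iteratedFDeriv ℝ h (mollify u i) x w =
      ∫ t, iteratedFDeriv ℝ h φ t w * u (x - t) :=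
    iteratedFDeriv_convolution_apply hφ hc hu.locallyIntegrable h x w
  have h2 := (hu.2 h hm dirs).2 (fun z => φ (x - z)) (hφ.comp (by fun_prop))
    (hc.comp_homeomorph (Homeomorph.subLeft x))
  rw [h1]
  calc ∫ t, iteratedFDeriv ℝ h φ t w * u (x - t)
      = ∫ t, iteratedFDeriv ℝ h φ (x - t) w * u t := by
        rw [← integral_sub_left_eq_self _ volume x]
        simp
    _ = (-1) ^ h * ∫ t, u t * iteratedFDeriv ℝ h (fun z => φ (x - z)) t w := by
        rw [← integral_const_mul]
        congr 1; ext t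
        rw [hφ.iteratedFDeriv_comp_const_sub]
        have : ((-1 : ℝ) ^ h) * (-1) ^ h = 1 := by rw [← mul_pow]; norm_num
        linear_combination (- iteratedFDeriv ℝ h φ (x - t) w * u t) * this
    _ = ∫ t, D h t dirs * φ (x - t) := by
        rw [h2, ← mul_assoc, ← mul_pow]; norm_num
    _ = mollify (fun x => D h x dirs) i x := by
        unfold mollify
        rw [← integral_sub_left_eq_self _ volume x]
        congr 1; ext t
        simp only [sub_sub_cancel]
        rw [mul_comm]

lemma HasWeakDerivs.tendsto_iteratedFDeriv_mollify {n m : ℕ} {u : Euc n → ℝ}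
    {D : (h : ℕ) → Euc n → (Fin h → Fin n) → ℝ} (hu : HasWeakDerivs n m u D) {h : ℕ}
    (hm : h ≤ m) (dirs : Fin h → Fin n) (x₀ : Euc n) (r : ℝ) :
    Tendsto (fun i => ∫⁻ x in ball x₀ r,
      ‖iteratedFDeriv ℝ h (mollify u i) x (fun j => EuclideanSpace.single (dirs j) (1 : ℝ)) -
        D h x dirs‖ₑ) atTop (𝓝 0) := by
  simp only [hu.iteratedFDeriv_mollify hm]
  exact tendsto_mollify (hu.2 h hm dirs).1 x₀ r

lemma poincare_of_tendsto {n : ℕ} {f : Euc n → ℝ} (hf : AEMeasurable f volume)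
    {g : Fin n → Euc n → ℝ} (hg : ∀ a, AEMeasurable (g a) volume) {F : ℕ → Euc n → ℝ} (hF : ∀ i, ContDiff ℝ 1 (F i))
    (x₀ : Euc n) (r : ℝ)
    (h0 : Tendsto (fun i => ∫⁻ x in ball x₀ r, ‖F i x - f x‖ₑ) atTop (𝓝 0))
    (h1 : ∀ a, Tendsto (fun i => ∫⁻ x in ball x₀ r,
      ‖fderiv ℝ (F i) x (EuclideanSpace.single a 1) - g a x‖ₑ) atTop (𝓝 0)) :
    ∫⁻ y in ball x₀ r, ∫⁻ z in ball x₀ r, ‖f y - f z‖ₑ ≤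
      2 ^ (n + 2) * ENNReal.ofReal r * volume (ball x₀ r) *
        ∑ a, ∫⁻ x in ball x₀ r, ‖g a x‖ₑ := by
  set V := volume (ball x₀ r) with hV
  have hVt : V ≠ ⊤ := volume_ball_ne_top x₀ r
  set K : ℝ≥0∞ := 2 ^ (n + 2) * ENNReal.ofReal r * V with hK
  have hKt : K ≠ ⊤ := ENNReal.mul_ne_top (by finiteness) hVt
  have key : ∀ i, ∫⁻ y in ball x₀ r, ∫⁻ z in ball x₀ r, ‖f y - f z‖ₑ ≤
      (∫⁻ x in ball x₀ r, ‖F i x - f x‖ₑ) * V +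
        (K * (∑ a, ((∫⁻ x in ball x₀ r, ‖g a x‖ₑ) + ∫⁻ x in ball x₀ r,
            ‖fderiv ℝ (F i) x (EuclideanSpace.single a 1) - g a x‖ₑ)) +
          (∫⁻ x in ball x₀ r, ‖F i x - f x‖ₑ) * V) := by
    intro i
    have hFm : Measurable (F i) := (hF i).continuous.measurable
    have hm : AEMeasurable (fun y => ‖F i y - f y‖ₑ) (volume.restrict (ball x₀ r)) :=
      (hFm.aemeasurable.sub hf.restrict).enorm
    set e := ∫⁻ x in ball x₀ r, ‖F i x - f x‖ₑ with he
    calc ∫⁻ y in ball x₀ r, ∫⁻ z in ball x₀ r, ‖f y - f z‖ₑ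
        ≤ ∫⁻ y in ball x₀ r, ∫⁻ z in ball x₀ r,
            (‖F i y - f y‖ₑ + (‖F i y - F i z‖ₑ + ‖F i z - f z‖ₑ)) := by
          refine lintegral_mono fun y => lintegral_mono fun z => ?_
          have : f y - f z = -(F i y - f y) + ((F i y - F i z) + (F i z - f z)) := by ring
          rw [this]
          refine (enorm_add_le _ _).trans ?_
          rw [enorm_neg]
          gcongr
          exact enorm_add_le _ _
      _ = ∫⁻ y in ball x₀ r, (‖F i y - f y‖ₑ * V +
            ((∫⁻ z in ball x₀ r, ‖F i y - F i z‖ₑ) + e)) := by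
          congr 1; ext y
          rw [lintegral_add_left measurable_const, lintegral_add_left (by fun_prop)]
          simp [he, hV]
      _ = e * V + ((∫⁻ y in ball x₀ r, ∫⁻ z in ball x₀ r, ‖F i y - F i z‖ₑ) + e * V) := by
          rw [lintegral_add_left' (hm.mul_const _), lintegral_add_right _ measurable_const,
            lintegral_mul_const' _ _ hVt, ← he]
          simp [hV]
      _ ≤ _ := by
          gcongr
          refine (poincare_smooth (hF i) x₀ r).trans ?_
          gcongr with a
          set L := fun x => fderiv ℝ (F i) x (EuclideanSpace.single a 1) with hL
          have hLm : Measurable L :=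
            (((hF i).continuous_fderiv (by simp)).clm_apply continuous_const).measurable
          calc ∫⁻ x in ball x₀ r, ‖L x‖ₑ ≤ ∫⁻ x in ball x₀ r, (‖g a x‖ₑ + ‖L x - g a x‖ₑ) := by
                refine lintegral_mono fun x => ?_
                have : L x = g a x + (L x - g a x) := by ring
                conv_lhs => rw [this]
                exact enorm_add_le _ _
            _ ≤ _ := by
                rw [lintegral_add_left' (hg a).restrict.enorm]
  have hlim : Tendsto (fun i => (∫⁻ x in ball x₀ r, ‖F i x - f x‖ₑ) * V +
        (K * (∑ a, ((∫⁻ x in ball x₀ r, ‖g a x‖ₑ) + ∫⁻ x in ball x₀ r,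
            ‖fderiv ℝ (F i) x (EuclideanSpace.single a 1) - g a x‖ₑ)) +
          (∫⁻ x in ball x₀ r, ‖F i x - f x‖ₑ) * V)) atTop
      (𝓝 (0 * V + (K * (∑ a, ((∫⁻ x in ball x₀ r, ‖g a x‖ₑ) + 0)) + 0 * V))) := by
    refine (ENNReal.Tendsto.mul_const h0 (.inr hVt)).add (.add (ENNReal.Tendsto.const_mul
      (tendsto_finsetSum _ fun a _ => tendsto_const_nhds.add (h1 a)) (.inr hKt))
      (ENNReal.Tendsto.mul_const h0 (.inr hVt)))
  have := ge_of_tendsto hlim (Eventually.of_forall key)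
  simpa using this

/-- The partial derivative of order `h` of `Q` along the coordinate directions `dirs`. -/
noncomputable def partialDeriv {n : ℕ} (Q : Euc n → ℝ) (h : ℕ) (x : Euc n)
    (dirs : Fin h → Fin n) : ℝ :=
  iteratedFDeriv ℝ h Q x fun j => EuclideanSpace.single (dirs j) (1 : ℝ)

lemma contDiff_partialDeriv {n : ℕ} {Q : Euc n → ℝ} (hQ : ContDiff ℝ (⊤ : ℕ∞) Q) (h : ℕ)
    (dirs : Fin h → Fin n) : ContDiff ℝ (⊤ : ℕ∞) fun x => partialDeriv Q h x dirs :=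
  hQ.iteratedFDeriv_apply_const h _

lemma fderiv_partialDeriv {n : ℕ} {Q : Euc n → ℝ} (hQ : ContDiff ℝ (⊤ : ℕ∞) Q) (h : ℕ)
    (x : Euc n) (dirs : Fin h → Fin n) (a : Fin n) :
    fderiv ℝ (fun y => partialDeriv Q h y dirs) x (EuclideanSpace.single a 1) =
      partialDeriv Q (h + 1) x (Fin.cons a dirs) := by
  unfold partialDeriv
  rw [hQ.iteratedFDeriv_succ_eq_fderiv]
  rfl

lemma HasWeakDerivs.poincare {n m : ℕ} {u : Euc n → ℝ}
    {D : (h : ℕ) → Euc n → (Fin h → Fin n) → ℝ} (hu : HasWeakDerivs n m u D) {h : ℕ}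
    (hm : h + 1 ≤ m) {Q : Euc n → ℝ} (hQ : ContDiff ℝ (⊤ : ℕ∞) Q) (dirs : Fin h → Fin n)
    (x₀ : Euc n) (r : ℝ) :
    ∫⁻ y in ball x₀ r, ∫⁻ z in ball x₀ r,
        ‖(D h y dirs - partialDeriv Q h y dirs) - (D h z dirs - partialDeriv Q h z dirs)‖ₑ ≤
      2 ^ (n + 2) * ENNReal.ofReal r * volume (ball x₀ r) *
        ∑ a, ∫⁻ x in ball x₀ r,
          ‖D (h + 1) x (Fin.cons a dirs) - partialDeriv Q (h + 1) x (Fin.cons a dirs)‖ₑ := by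
  have hM := contDiff_mollify hu.locallyIntegrable
  refine poincare_of_tendsto (F := fun i x =>
    partialDeriv (mollify u i) h x dirs - partialDeriv Q h x dirs) ?_ (fun a => ?_) ?_ x₀ r ?_ ?_
  · exact (hu.2 h (by lia) dirs).1.aestronglyMeasurable.aemeasurable.sub
      (contDiff_partialDeriv hQ h dirs).continuous.measurable.aemeasurable
  · exact (hu.2 (h + 1) hm _).1.aestronglyMeasurable.aemeasurable.sub
      (contDiff_partialDeriv hQ (h + 1) _).continuous.measurable.aemeasurable
  · intro i
    exact ((contDiff_partialDeriv (hM i) h dirs).sub (contDiff_partialDeriv hQ h dirs)).of_le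
      (by simp)
  · simpa [partialDeriv] using hu.tendsto_iteratedFDeriv_mollify (by lia : h ≤ m) dirs x₀ r
  · intro a
    refine (hu.tendsto_iteratedFDeriv_mollify hm (Fin.cons a dirs) x₀ r).congr fun i => ?_
    congr 1; ext x
    rw [fderiv_fun_sub ((contDiff_partialDeriv (hM i) h dirs).differentiable (by simp) x)
      ((contDiff_partialDeriv hQ h dirs).differentiable (by simp) x)]
    rw [sub_apply, fderiv_partialDeriv (hM i), fderiv_partialDeriv hQ,
      sub_sub_sub_cancel_right]
    rfl

/-- The polynomial function on Euclidean space associated with `P`. -/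
noncomputable abbrev polyFun {n : ℕ} (P : MvPolynomial (Fin n) ℝ) : Euc n → ℝ :=
  fun y => MvPolynomial.eval (fun i => y i) P

lemma contDiff_polyFun {n : ℕ} (P : MvPolynomial (Fin n) ℝ) :
    ContDiff ℝ (⊤ : ℕ∞) (polyFun P) := by
  induction P using MvPolynomial.induction_on with
  | C a =>
    unfold polyFun
    simpa using (contDiff_const : ContDiff ℝ (⊤ : ℕ∞) fun _ : Euc n => a)
  | add p q hp hq =>
    unfold polyFun at *
    simp only [map_add]
    exact hp.add hq
  | mul_X p i hp =>
    have : ContDiff ℝ (⊤ : ℕ∞) fun y : Euc n => y i := by fun_prop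
    unfold polyFun at *
    simp only [map_mul, MvPolynomial.eval_X]
    exact hp.mul this

lemma partialDeriv_add {n : ℕ} {P Q : Euc n → ℝ} (hP : ContDiff ℝ (⊤ : ℕ∞) P)
    (hQ : ContDiff ℝ (⊤ : ℕ∞) Q) (h : ℕ) (x : Euc n) (dirs : Fin h → Fin n) :
    partialDeriv (P + Q) h x dirs = partialDeriv P h x dirs + partialDeriv Q h x dirs := by
  unfold partialDeriv
  have hle : (h : WithTop ℕ∞) ≤ ((⊤ : ℕ∞) : WithTop ℕ∞) := WithTop.coe_le_coe.2 le_top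
  rw [iteratedFDeriv_add_apply (hP.contDiffAt.of_le hle) (hQ.contDiffAt.of_le hle)]
  rfl

lemma partialDeriv_succ_eq_zero {n : ℕ} {Q : Euc n → ℝ} (hQ : ContDiff ℝ (⊤ : ℕ∞) Q) {h : ℕ}
    {c : (Fin h → Fin n) → ℝ} (hc : ∀ x dirs, partialDeriv Q h x dirs = c dirs) (x : Euc n)
    (dirs : Fin (h + 1) → Fin n) : partialDeriv Q (h + 1) x dirs = 0 := by
  rw [← Fin.cons_self_tail dirs, ← fderiv_partialDeriv hQ]
  simp [hc]

lemma partialDeriv_comp_perm {n : ℕ} {Q : Euc n → ℝ} (hQ : ContDiff ℝ (⊤ : ℕ∞) Q) {h : ℕ}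
    (x : Euc n) (dirs : Fin h → Fin n) (σ : Equiv.Perm (Fin h)) :
    partialDeriv Q h x (dirs ∘ σ) = partialDeriv Q h x dirs :=
  hQ.iteratedFDeriv_comp_perm_of_smooth σ x fun j => EuclideanSpace.single (dirs j) (1 : ℝ)

lemma integrableOn_partialDeriv {n : ℕ} {Q : Euc n → ℝ} (hQ : ContDiff ℝ (⊤ : ℕ∞) Q) (h : ℕ)
    (dirs : Fin h → Fin n) (x₀ : Euc n) (r : ℝ) :
    IntegrableOn (fun x => partialDeriv Q h x dirs) (ball x₀ r) volume :=
  ((contDiff_partialDeriv hQ h dirs).continuous.locallyIntegrable.integrableOn_isCompact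
    (isCompact_closedBall x₀ r)).mono_set ball_subset_closedBall

/-- A symmetric array is the array of top-order derivatives of a polynomial. -/
lemma exists_polyFun_partialDeriv_eq {n k : ℕ} {a : (Fin k → Fin n) → ℝ}
    (ha : ∀ dirs (σ : Equiv.Perm (Fin k)), a (dirs ∘ σ) = a dirs) :
    ∃ Q : MvPolynomial (Fin n) ℝ, Q.totalDegree ≤ k ∧
      ∀ x dirs, partialDeriv (polyFun Q) k x dirs = a dirs := by
  classical
  let M : ContinuousMultilinearMap ℝ (fun _ : Fin k => Euc n) ℝ :=
    ∑ d : Fin k → Fin n, (a d / (k.factorial : ℝ)) •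
      (ContinuousMultilinearMap.mkPiAlgebra ℝ (Fin k) ℝ).compContinuousLinearMap
        fun i => (EuclideanSpace.proj (d i) : Euc n →L[ℝ] ℝ)
  have hM : ∀ v : Fin k → Euc n,
      M v = ∑ d : Fin k → Fin n, (a d / (k.factorial : ℝ)) * ∏ i, v i (d i) := by
    intro v; simp [M]
  let Q : MvPolynomial (Fin n) ℝ := ∑ d : Fin k → Fin n,
    MvPolynomial.C (a d / (k.factorial : ℝ)) * ∏ i, MvPolynomial.X (d i)
  have hQM : polyFun Q = fun x => M fun _ => x := by
    ext x; simp [polyFun, Q, hM]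
  refine ⟨Q, ?_, fun x dirs => ?_⟩
  · refine (MvPolynomial.totalDegree_finsetSum _ _).trans (Finset.sup_le fun d _ => ?_)
    refine (MvPolynomial.totalDegree_mul _ _).trans ?_
    rw [MvPolynomial.totalDegree_C, zero_add]
    refine (MvPolynomial.totalDegree_finsetProd _ _).trans ?_
    simp
  · have hsymm : ∀ σ : Equiv.Perm (Fin k),
        M (fun i => EuclideanSpace.single (dirs (σ i)) (1 : ℝ)) = a dirs / k.factorial := by
      intro σ
      rw [hM, Finset.sum_eq_single (dirs ∘ σ)]
      · simp [ha]
      · intro d _ hd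
        obtain ⟨i, hi⟩ := Function.ne_iff.1 hd
        rw [Finset.prod_eq_zero (Finset.mem_univ i), mul_zero]
        simpa using fun h => hi h
      · simp
    unfold partialDeriv
    rw [hQM, ContinuousMultilinearMap.iteratedFDeriv_comp_diagonal]
    simp only [hsymm]
    simp [Fintype.card_perm]
    field_simp

lemma exists_polyFun_integral_eq {n : ℕ} (k : ℕ) {x₀ : Euc n} {r : ℝ} (hr : 0 < r)
    (a : (h : ℕ) → (Fin h → Fin n) → ℝ)
    (ha : ∀ h, h < k → ∀ dirs (σ : Equiv.Perm (Fin h)), a h (dirs ∘ σ) = a h dirs) :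
    ∃ P : MvPolynomial (Fin n) ℝ, P.totalDegree ≤ k - 1 ∧
      (∀ h, h < k → ∀ dirs, ∫ x in ball x₀ r, partialDeriv (polyFun P) h x dirs = a h dirs) ∧
      ∀ x dirs, partialDeriv (polyFun P) k x dirs = 0 := by
  induction k generalizing a with
  | zero => exact ⟨0, by simp, by simp, by simp [partialDeriv, polyFun]⟩
  | succ k ih =>
    set V := volume.real (ball x₀ r) with hV
    have hV0 : V ≠ 0 := by
      rw [hV, Measure.real, Ne, ENNReal.toReal_eq_zero_iff, not_or]
      exact ⟨volume_ball_ne_zero x₀ hr, volume_ball_ne_top x₀ r⟩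
    obtain ⟨Q, hQdeg, hQ⟩ := exists_polyFun_partialDeriv_eq (k := k) (a := fun d => a k d / V)
      (fun dirs σ => by simp only [ha k (by lia)])
    have hQs := contDiff_polyFun Q
    obtain ⟨P, hPdeg, hP, hP0⟩ := ih
      (fun h dirs => a h dirs - ∫ x in ball x₀ r, partialDeriv (polyFun Q) h x dirs)
      (fun h hh dirs σ => by
        simp only [ha h (by lia)]
        simp only [partialDeriv_comp_perm hQs])
    have hPs := contDiff_polyFun P
    have hadd : polyFun (P + Q) = polyFun P + polyFun Q := by ext; simp [polyFun]
    refine ⟨P + Q, ?_, fun h hh dirs => ?_, fun x dirs => ?_⟩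
    · exact (MvPolynomial.totalDegree_add _ _).trans (max_le (by lia) (by lia))
    · simp only [hadd, partialDeriv_add hPs hQs]
      rw [integral_add (integrableOn_partialDeriv hPs h dirs x₀ r)
        (integrableOn_partialDeriv hQs h dirs x₀ r)]
      rcases (Nat.lt_succ_iff_lt_or_eq).1 hh with hlt | rfl
      · rw [hP h hlt]; ring
      · simp only [hP0, hQ]
        simp [← hV]
        field_simp
    · rw [hadd, partialDeriv_add hPs hQs, partialDeriv_succ_eq_zero hPs (c := 0) hP0,
        partialDeriv_succ_eq_zero hQs hQ, add_zero]

lemma HasWeakDerivs.integral_comp_perm {n m : ℕ} {u : Euc n → ℝ}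
    {D : (h : ℕ) → Euc n → (Fin h → Fin n) → ℝ} (hu : HasWeakDerivs n m u D) {h : ℕ}
    (hm : h ≤ m) (dirs : Fin h → Fin n) (σ : Equiv.Perm (Fin h)) (x₀ : Euc n) (r : ℝ) :
    ∫ x in ball x₀ r, D h x (dirs ∘ σ) = ∫ x in ball x₀ r, D h x dirs := by
  have meas : ∀ d, AEMeasurable (fun x => D h x d) volume := fun d =>
    (hu.2 h hm d).1.aestronglyMeasurable.aemeasurable
  have key : ∫⁻ x in ball x₀ r, ‖D h x (dirs ∘ σ) - D h x dirs‖ₑ ≤ 0 := by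
    have hlim := (hu.tendsto_iteratedFDeriv_mollify hm (dirs ∘ σ) x₀ r).add
      (hu.tendsto_iteratedFDeriv_mollify hm dirs x₀ r)
    rw [add_zero] at hlim
    refine ge_of_tendsto hlim (Eventually.of_forall fun i => ?_)
    have hs := contDiff_mollify hu.locallyIntegrable i
    have h2 : AEMeasurable (fun x => ‖partialDeriv (mollify u i) h x (dirs ∘ σ) -
        D h x (dirs ∘ σ)‖ₑ) (volume.restrict (ball x₀ r)) := (((contDiff_partialDeriv hs h (dirs ∘ σ)).continuous.measurable
      |>.aemeasurable.sub (meas _)).restrict.enorm)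
    refine le_of_le_of_eq ?_ (lintegral_add_left' h2 _)
    refine lintegral_mono fun x => ?_
    have h1 : D h x (dirs ∘ σ) - D h x dirs =
        -(partialDeriv (mollify u i) h x (dirs ∘ σ) - D h x (dirs ∘ σ)) +
          (partialDeriv (mollify u i) h x dirs - D h x dirs) := by
      rw [partialDeriv_comp_perm hs]; ring
    rw [h1]
    refine (enorm_add_le _ _).trans ?_
    rw [enorm_neg]; rfl
  have h0 := (lintegral_eq_zero_iff' ((meas _).sub (meas _)).restrict.enorm).1 (le_zero_iff.1 key)
  refine integral_congr_ae (h0.mono fun x hx => ?_)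
  simpa [sub_eq_zero] using hx

lemma HasWeakDerivs.exists_isCampPoly {n m k : ℕ} {u : Euc n → ℝ}
    {D : (h : ℕ) → Euc n → (Fin h → Fin n) → ℝ} (hu : HasWeakDerivs n m u D) (hk : k ≤ m)
    (x₀ : Euc n) {r : ℝ} (hr : 0 < r) :
    ∃ P : MvPolynomial (Fin n) ℝ, IsCampPoly n k D (ball x₀ r) P ∧
      ∀ x dirs, partialDeriv (polyFun P) (k + 1) x dirs = 0 := by
  obtain ⟨P, h1, h2, h3⟩ := exists_polyFun_integral_eq (k + 1) (x₀ := x₀) hr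
    (fun h dirs => ∫ x in ball x₀ r, D h x dirs)
    (fun h hh dirs σ => hu.integral_comp_perm (by lia) dirs σ x₀ r)
  exact ⟨P, ⟨by simpa using h1, fun h hh dirs => (h2 h (by lia) dirs).symm⟩, h3⟩

lemma Fin.sum_sum_cons {M : Type*} [AddCommMonoid M] {n h : ℕ} (G : (Fin (h + 1) → Fin n) → M) :
    ∑ dirs : Fin h → Fin n, ∑ a, G (Fin.cons a dirs) = ∑ dirs, G dirs := by
  rw [Finset.sum_comm, ← Fintype.sum_prod_type' (fun a dirs => G (Fin.cons a dirs))]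
  exact Fintype.sum_equiv (Fin.consEquiv fun _ => Fin n) _ _ fun _ => rfl

lemma measure_mul_lintegral_enorm_le_of_integral_eq_zero {α : Type*} [MeasurableSpace α]
    {μ : Measure α} [IsFiniteMeasure μ] {f : α → ℝ} (hf : Integrable f μ) (h0 : ∫ x, f x ∂μ = 0) :
    μ univ * ∫⁻ x, ‖f x‖ₑ ∂μ ≤ ∫⁻ y, ∫⁻ z, ‖f y - f z‖ₑ ∂μ ∂μ := by
  rw [← lintegral_const_mul' _ _ (measure_ne_top μ univ)]
  refine lintegral_mono fun y => ?_
  calc μ univ * ‖f y‖ₑ = ‖∫ z, (f y - f z) ∂μ‖ₑ := by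
        rw [integral_sub (integrable_const _) hf, h0, integral_const, sub_zero, enorm_smul,
          Measure.real, Real.enorm_of_nonneg ENNReal.toReal_nonneg,
          ENNReal.ofReal_toReal (measure_ne_top μ univ)]
    _ ≤ _ := enorm_integral_le_lintegral_enorm _

lemma HasWeakDerivs.lintegral_sub_polyFun_le {n m k : ℕ} {u : Euc n → ℝ}
    {D : (h : ℕ) → Euc n → (Fin h → Fin n) → ℝ} (hu : HasWeakDerivs n m u D) (hk : k + 1 ≤ m)
    {x₀ : Euc n} {r : ℝ} (hr : 0 < r) {P : MvPolynomial (Fin n) ℝ}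
    (hP : IsCampPoly n k D (ball x₀ r) P)
    (hP0 : ∀ x dirs, partialDeriv (polyFun P) (k + 1) x dirs = 0) :
    ∫⁻ x in ball x₀ r, ‖u x - polyFun P x‖ₑ ≤
      (2 ^ (n + 2) * ENNReal.ofReal r) ^ (k + 1) *
        ∑ dirs, ∫⁻ x in ball x₀ r, ‖D (k + 1) x dirs‖ₑ := by
  have hPs := contDiff_polyFun P
  set b : ℕ → ℝ≥0∞ := fun h =>
    ∑ dirs, ∫⁻ x in ball x₀ r, ‖D h x dirs - partialDeriv (polyFun P) h x dirs‖ₑ with hb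
  have hV0 := volume_ball_ne_zero x₀ hr
  have hVt := volume_ball_ne_top x₀ r
  have step : ∀ h, h ≤ k → b h ≤ (2 ^ (n + 2) * ENNReal.ofReal r) * b (h + 1) := by
    intro h hh
    simp only [hb]
    rw [← Fin.sum_sum_cons, Finset.mul_sum]
    refine Finset.sum_le_sum fun dirs _ => ?_
    refine (ENNReal.mul_le_mul_iff_right hV0 hVt).1 ?_
    have : IsFiniteMeasure (volume.restrict (ball x₀ r)) :=
      ⟨by rw [Measure.restrict_apply_univ]; exact hVt.lt_top⟩
    have hD : IntegrableOn (fun x => D h x dirs) (ball x₀ r) volume :=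
      ((hu.2 h (by lia) dirs).1.integrableOn_isCompact
        (isCompact_closedBall x₀ r)).mono_set ball_subset_closedBall
    have hQ := integrableOn_partialDeriv hPs h dirs x₀ r
    have h1 := measure_mul_lintegral_enorm_le_of_integral_eq_zero
      (μ := volume.restrict (ball x₀ r)) (hD.sub hQ) (by
        simp only [Pi.sub_apply]
        rw [integral_sub hD hQ, sub_eq_zero]
        exact hP.2 h hh dirs)
    simp only [Measure.restrict_apply_univ, Pi.sub_apply] at h1
    refine h1.trans ((hu.poincare (by lia) hPs dirs x₀ r).trans_eq ?_)
    ring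
  have iter : ∀ i, i ≤ k + 1 → b 0 ≤ (2 ^ (n + 2) * ENNReal.ofReal r) ^ i * b i := by
    generalize 2 ^ (n + 2) * ENNReal.ofReal r = K at step ⊢
    intro i
    induction i with
    | zero => simp
    | succ i ih =>
      intro hi
      refine (ih (by lia)).trans ?_
      rw [pow_succ, mul_assoc]
      gcongr
      exact step i (by lia)
  have hb0 : b 0 = ∫⁻ x in ball x₀ r, ‖u x - polyFun P x‖ₑ := by
    simp [hb, partialDeriv, hu.1]
  have hbk : b (k + 1) = ∑ dirs, ∫⁻ x in ball x₀ r, ‖D (k + 1) x dirs‖ₑ := by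
    simp only [hb, hP0, sub_zero]
  rw [← hb0, ← hbk]
  exact iter (k + 1) le_rfl

/-- The sum of the averages over a ball of the derivatives of order `h`. -/
noncomputable def gradAvg {n : ℕ} (D : (h : ℕ) → Euc n → (Fin h → Fin n) → ℝ) (h : ℕ)
    (x : Euc n) (r : ℝ) : ℝ≥0∞ :=
  ∑ dirs, ballAvg (fun y => D h y dirs) x r

/-- The sum of the mean oscillations over a ball of the derivatives of order `h`. -/
noncomputable def gradOsc {n : ℕ} (D : (h : ℕ) → Euc n → (Fin h → Fin n) → ℝ) (h : ℕ)
    (x : Euc n) (r : ℝ) : ℝ≥0∞ :=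
  ∑ dirs, ballOsc (fun y => D h y dirs) x r

lemma HasWeakDerivs.ballAvg_sub_polyFun_le {n m k : ℕ} {u : Euc n → ℝ}
    {D : (h : ℕ) → Euc n → (Fin h → Fin n) → ℝ} (hu : HasWeakDerivs n m u D) (hk : k + 1 ≤ m)
    {x₀ : Euc n} {r : ℝ} (hr : 0 < r) {P : MvPolynomial (Fin n) ℝ}
    (hP : IsCampPoly n k D (ball x₀ r) P)
    (hP0 : ∀ x dirs, partialDeriv (polyFun P) (k + 1) x dirs = 0) :
    ballAvg (fun x => u x - polyFun P x) x₀ r ≤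
      (2 ^ (n + 2) * ENNReal.ofReal r) ^ (k + 1) * gradAvg D (k + 1) x₀ r := by
  unfold ballAvg gradAvg ballAvg
  rw [← Finset.mul_sum, mul_left_comm]
  gcongr
  exact hu.lintegral_sub_polyFun_le hk hr hP hP0

lemma HasWeakDerivs.gradOsc_le {n m h : ℕ} {u : Euc n → ℝ}
    {D : (h : ℕ) → Euc n → (Fin h → Fin n) → ℝ} (hu : HasWeakDerivs n m u D) (hm : h + 1 ≤ m)
    (x : Euc n) {r : ℝ} (hr : 0 < r) :
    gradOsc D h x r ≤ 2 ^ (n + 2) * ENNReal.ofReal r * gradAvg D (h + 1) x r := by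
  unfold gradOsc gradAvg
  rw [← Fin.sum_sum_cons, Finset.mul_sum]
  refine Finset.sum_le_sum fun dirs _ => ?_
  have hV0 := volume_ball_ne_zero x hr
  have hVt := volume_ball_ne_top x r
  have h1 := hu.poincare hm (contDiff_polyFun 0) dirs x r
  have hz : ∀ (h : ℕ) (y : Euc n) (d : Fin h → Fin n), partialDeriv (polyFun 0) h y d = 0 := by
    intro h y d
    have : (polyFun 0 : Euc n → ℝ) = fun _ => 0 := by ext; simp [polyFun]
    simp [this, partialDeriv]
  simp only [hz, sub_zero] at h1
  unfold ballOsc ballAvg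
  rw [← Finset.mul_sum]
  calc _ ≤ (volume (ball x r))⁻¹ * ((volume (ball x r))⁻¹ *
        (2 ^ (n + 2) * ENNReal.ofReal r * volume (ball x r) *
          ∑ a, ∫⁻ y in ball x r, ‖D (h + 1) y (Fin.cons a dirs)‖ₑ)) := by gcongr
    _ = ((volume (ball x r))⁻¹ * volume (ball x r)) * (2 ^ (n + 2) * ENNReal.ofReal r *
          ((volume (ball x r))⁻¹ *
            ∑ a, ∫⁻ y in ball x r, ‖D (h + 1) y (Fin.cons a dirs)‖ₑ)) := by ring
    _ = _ := by rw [ENNReal.inv_mul_cancel hV0 hVt, one_mul]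

lemma HasWeakDerivs.gradAvg_le_tsum {n m h : ℕ} (hn : 0 < n) {u : Euc n → ℝ}
    {D : (h : ℕ) → Euc n → (Fin h → Fin n) → ℝ} (hu : HasWeakDerivs n m u D) {k : ℕ}
    (hd : DecayFrom n k m D) (hk : k ≤ h) (hm : h ≤ m) (x : Euc n) {r : ℝ} (hr : 0 < r) :
    gradAvg D h x r ≤ (2 ^ n + 2) * ∑' l : ℕ, gradOsc D h x (2 ^ l * r) := by
  unfold gradAvg gradOsc
  rw [Summable.tsum_finsetSum fun _ _ => ENNReal.summable, Finset.mul_sum]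
  refine Finset.sum_le_sum fun dirs _ => ?_
  refine ballAvg_le_tsum hn (hu.2 h hm dirs).1.aestronglyMeasurable.aemeasurable
    (fun t ht => ?_) x hr
  refine (measure_mono fun y hy => ?_).trans_lt (hd h hk hm t ht)
  refine lt_of_lt_of_le (mem_ofPred_eq.mp hy) (Real.abs_le_sqrt ?_)
  exact Finset.single_le_sum (f := fun d => D h y d ^ 2) (fun _ _ => sq_nonneg _)
    (Finset.mem_univ dirs)

lemma ENNReal.tsum_two_pow_mul_tsum_add_le (g : ℕ → ℝ≥0∞) :
    ∑' l : ℕ, 2 ^ l * ∑' i : ℕ, g (l + i) ≤ 2 * ∑' p : ℕ, 2 ^ p * g p := by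
  have h1 : ∀ l : ℕ, ∑' i : ℕ, g (l + i) = ∑' p : ℕ, if l ≤ p then g p else 0 := by
    intro l
    rw [← (Equiv.refl ℕ).tsum_eq]
    have hinj : Function.Injective fun i : ℕ => l + i := fun a b h => by simpa using h
    rw [← hinj.tsum_eq (f := fun p => if l ≤ p then g p else 0)]
    · simp
    · intro p hp
      have : l ≤ p := by
        by_contra hc
        simp [hc] at hp
      exact ⟨p - l, by simp; lia⟩
  simp only [h1, ← ENNReal.tsum_mul_left]
  rw [ENNReal.tsum_comm]
  refine ENNReal.tsum_le_tsum fun p => ?_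
  have h2 : ∀ l ∉ Finset.range (p + 1), (2 : ℝ≥0∞) ^ l * (if l ≤ p then g p else 0) = 0 := by
    intro l hl
    simp at hl
    simp [show ¬ l ≤ p by lia]
  rw [tsum_eq_sum h2]
  calc ∑ l ∈ Finset.range (p + 1), (2 : ℝ≥0∞) ^ l * (if l ≤ p then g p else 0)
      = (∑ l ∈ Finset.range (p + 1), (2 : ℝ≥0∞) ^ l) * g p := by
        rw [Finset.sum_mul]
        refine Finset.sum_congr rfl fun l hl => ?_
        simp at hl
        simp [show l ≤ p by lia]
    _ ≤ (2 * 2 ^ p) * g p := by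
        gcongr
        have : (∑ l ∈ Finset.range (p + 1), 2 ^ l : ℕ) ≤ 2 * 2 ^ p := by
          rw [Nat.geomSum_eq le_rfl]
          simp [pow_succ, mul_comm]
        exact_mod_cast this
    _ = _ := by ring

/-- Averages of lower-order derivatives are controlled by weighted dyadic oscillations of the
derivatives of top order. -/
lemma HasWeakDerivs.gradAvg_le_tsum_pow {n m : ℕ} (hn : 0 < n) {u : Euc n → ℝ}
    {D : (h : ℕ) → Euc n → (Fin h → Fin n) → ℝ} (hu : HasWeakDerivs n m u D) {k : ℕ}
    (hd : DecayFrom n k m D) (j : ℕ) {h : ℕ} (hk : k ≤ h) (hm : h + j = m) (x : Euc n) {r : ℝ}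
    (hr : 0 < r) :
    gradAvg D h x r ≤ ((2 ^ n + 2) ^ (j + 1) * (2 ^ (n + 3)) ^ j) *
      ∑' l : ℕ, ENNReal.ofReal (2 ^ l * r) ^ j * gradOsc D m x (2 ^ l * r) := by
  induction j generalizing h r with
  | zero =>
    obtain rfl : h = m := by lia
    simpa using hu.gradAvg_le_tsum hn hd hk le_rfl x hr
  | succ j ih =>
    have hpos : ∀ l : ℕ, 0 < 2 ^ l * r := fun l => by positivity
    set C : ℝ≥0∞ := (2 ^ n + 2) ^ (j + 1) * (2 ^ (n + 3)) ^ j with hC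
    set g : ℕ → ℝ≥0∞ := fun p => ENNReal.ofReal (2 ^ p * r) ^ j * gradOsc D m x (2 ^ p * r)
      with hg
    have ofp : ∀ l : ℕ, ENNReal.ofReal (2 ^ l * r) = 2 ^ l * ENNReal.ofReal r := fun l => by
      rw [ENNReal.ofReal_mul (by positivity), ENNReal.ofReal_pow (by norm_num)]; simp
    have h1 : ∀ l : ℕ, gradOsc D h x (2 ^ l * r) ≤
        2 ^ (n + 2) * ENNReal.ofReal r * C * (2 ^ l * ∑' i : ℕ, g (l + i)) := by
      intro l
      have h2 := ih (h := h + 1) (by lia) (by lia) (hpos l)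
      have h3 : ∀ i : ℕ, (2 : ℝ) ^ i * (2 ^ l * r) = 2 ^ (l + i) * r := fun i => by
        rw [pow_add]; ring
      simp only [h3] at h2
      calc _ ≤ 2 ^ (n + 2) * ENNReal.ofReal (2 ^ l * r) * gradAvg D (h + 1) x (2 ^ l * r) :=
            hu.gradOsc_le (by lia) x (hpos l)
        _ ≤ 2 ^ (n + 2) * ENNReal.ofReal (2 ^ l * r) * (C * ∑' i : ℕ, g (l + i)) := by gcongr
        _ = _ := by rw [ofp]; ring
    calc gradAvg D h x r ≤ (2 ^ n + 2) * ∑' l : ℕ, gradOsc D h x (2 ^ l * r) :=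
          hu.gradAvg_le_tsum hn hd hk (by lia) x hr
      _ ≤ (2 ^ n + 2) * ∑' l : ℕ,
            2 ^ (n + 2) * ENNReal.ofReal r * C * (2 ^ l * ∑' i : ℕ, g (l + i)) := by
          gcongr with l
          exact h1 l
      _ ≤ (2 ^ n + 2) * (2 ^ (n + 2) * ENNReal.ofReal r * C * (2 * ∑' p : ℕ, 2 ^ p * g p)) := by
          rw [ENNReal.tsum_mul_left]
          gcongr
          exact ENNReal.tsum_two_pow_mul_tsum_add_le g
      _ = (2 ^ n + 2) * C * 2 ^ (n + 3) * (ENNReal.ofReal r * ∑' p : ℕ, 2 ^ p * g p) := by ring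
      _ = _ := by
          rw [← ENNReal.tsum_mul_left]
          congr 1
          · rw [hC]; ring
          · congr 1; ext p
            simp only [hg, ofp]
            ring

lemma ofReal_mul_le_add_youngConj (A : ℝ → ℝ≥0∞) {a : ℝ} (b : ℝ) (ha : 0 ≤ a) :
    ENNReal.ofReal (a * b) ≤ A a + youngConj A b := by
  rw [← tsub_le_iff_left]
  exact le_iSup₂ (f := fun τ (_ : 0 ≤ τ) => ENNReal.ofReal (τ * b) - A τ) a ha

lemma youngConj_mono (A : ℝ → ℝ≥0∞) : Monotone (youngConj A) := by
  intro a b hab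
  refine iSup₂_mono fun τ hτ => ?_
  gcongr

/-- A dyadic lower bound for the function `F_k`. -/
lemma tsum_youngConj_le_Fk {n : ℕ} {s : ℝ} {k : ℕ} (A : ℝ → ℝ≥0∞) {β : ℝ}
    (hβ : β = n - s + k + 1) (hβ0 : 0 < β) {t : ℝ} (ht : 0 < t) :
    ENNReal.ofReal (1 - 2 ^ (-β)) *
        ∑' l : ℕ, 2 ^ (l * n) * youngConj A (t * (2 : ℝ) ^ (-((l + 1 : ℕ) * β))) ≤
      Fk n s k A t := by
  unfold Fk
  rw [← hβ]
  set p : ℝ := n / β with hp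
  set e : ℕ → ℝ := fun l => t * (2 : ℝ) ^ (-(l * β)) with he
  have hepos : ∀ l, 0 < e l := fun l => by positivity
  have hanti : Antitone e := by
    intro a b hab
    simp only [he]
    gcongr
    norm_num
  have hstep : ∀ l, e (l + 1) = e l * 2 ^ (-β) := by
    intro l
    simp only [he]
    rw [mul_assoc, ← Real.rpow_add (by norm_num)]
    congr 2; push_cast; ring
  have hpos1 : (2 : ℝ) ^ (-β) < 1 := Real.rpow_lt_one_of_one_lt_of_neg (by norm_num) (by linarith)
  have hpow : ∀ l : ℕ, t ^ p * (e l * e l ^ (-1 - p)) = 2 ^ (l * n) := by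
    intro l
    have h1 : e l * e l ^ (-1 - p) = e l ^ (-p) := by
      conv_lhs => rw [← Real.rpow_one (e l), ← Real.rpow_mul (hepos l).le,
        ← Real.rpow_add (hepos l)]
      congr 1; ring
    rw [h1, he]
    simp only
    rw [Real.mul_rpow ht.le (by positivity), ← mul_assoc, ← Real.rpow_add ht, ← Real.rpow_mul
      (by norm_num)]
    simp only [add_neg_cancel, Real.rpow_zero, one_mul]
    rw [← Real.rpow_natCast]
    congr 1
    push_cast
    rw [hp]; field_simp
  have hI : ∀ l : ℕ, ENNReal.ofReal (1 - 2 ^ (-β)) * (2 ^ (l * n) * youngConj A (e (l + 1))) ≤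
      ENNReal.ofReal (t ^ p) * ∫⁻ τ in Ioc (e (l + 1)) (e l),
        youngConj A τ * ENNReal.ofReal (τ ^ (-1 - p)) := by
    intro l
    calc ENNReal.ofReal (1 - 2 ^ (-β)) * (2 ^ (l * n) * youngConj A (e (l + 1)))
        = ENNReal.ofReal (t ^ p) * (youngConj A (e (l + 1)) * ENNReal.ofReal (e l ^ (-1 - p)) *
            ENNReal.ofReal (e l - e (l + 1))) := by
          have h2 : (2 : ℝ≥0∞) ^ (l * n) = ENNReal.ofReal (t ^ p) *
              (ENNReal.ofReal (e l) * ENNReal.ofReal (e l ^ (-1 - p))) := by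
            rw [← ENNReal.ofReal_mul (hepos l).le, ← ENNReal.ofReal_mul (by positivity), hpow,
              ENNReal.ofReal_pow (by norm_num)]
            simp
          have h3 : ENNReal.ofReal (e l - e (l + 1)) =
              ENNReal.ofReal (e l) * ENNReal.ofReal (1 - 2 ^ (-β)) := by
            rw [← ENNReal.ofReal_mul (hepos l).le, hstep]
            congr 1; ring
          rw [h2, h3]; ring
      _ = ENNReal.ofReal (t ^ p) * ∫⁻ τ in Ioc (e (l + 1)) (e l),
            youngConj A (e (l + 1)) * ENNReal.ofReal (e l ^ (-1 - p)) := by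
          rw [setLIntegral_const, Real.volume_Ioc]
      _ ≤ _ := by
          refine mul_le_mul' le_rfl ?_
          refine setLIntegral_mono' measurableSet_Ioc fun τ hτ => ?_
          have hτ0 : 0 < τ := (hepos _).trans hτ.1
          refine mul_le_mul' (youngConj_mono A hτ.1.le) ?_
          · refine ENNReal.ofReal_le_ofReal (Real.rpow_le_rpow_of_nonpos hτ0 hτ.2 ?_)
            have : 0 ≤ p := by positivity
            linarith
  rw [← ENNReal.tsum_mul_left]
  refine (ENNReal.tsum_le_tsum hI).trans ?_
  rw [ENNReal.tsum_mul_left]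
  refine mul_le_mul' le_rfl ?_
  rw [← lintegral_iUnion (fun _ => measurableSet_Ioc)]
  · refine lintegral_mono_set (iUnion_subset fun l τ hτ => ⟨(hepos _).trans hτ.1, hτ.2.trans ?_⟩)
    simpa [he] using hanti (Nat.zero_le l)
  · exact hanti.pairwise_disjoint_on_Ioc_succ

lemma tsum_lintegral_le_lintegral_tsum {α : Type*} [MeasurableSpace α] (μ : Measure α)
    (f : ℕ → α → ℝ≥0∞) : ∑' l, ∫⁻ x, f l x ∂μ ≤ ∫⁻ x, ∑' l, f l x ∂μ := by
  refine ENNReal.tsum_le_of_sum_range_le fun N => ?_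
  refine le_trans ?_ (lintegral_mono fun x => ENNReal.sum_le_tsum (Finset.range N))
  induction N with
  | zero => simp
  | succ N ih =>
    simp only [Finset.sum_range_succ]
    refine le_trans ?_ (le_lintegral_add _ _)
    gcongr

lemma sum_range_dyadic_truncation_le (N : ℕ) {ρ : ℝ} (hρ : 0 ≤ ρ) :
    ∑ l ∈ Finset.range N, (if ρ / 2 ^ l < 1 then ρ / 2 ^ l else 0) ≤ min 2 (2 * ρ) := by
  induction N generalizing ρ with
  | zero => simp; exact hρ
  | succ N ih =>
    rw [Finset.sum_range_succ']
    have h1 : ∀ l : ℕ, ρ / 2 ^ (l + 1) = (ρ / 2) / 2 ^ l := fun l => by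
      rw [pow_succ]; field_simp
    simp only [h1, pow_zero, div_one]
    have h2 := le_min_iff.1 (ih (ρ := ρ / 2) (by positivity))
    split_ifs with h
    · refine le_min ?_ ?_ <;> linarith [h2.2]
    · refine le_min ?_ ?_ <;> linarith [h2.1, h2.2]

lemma tsum_dyadic_truncation_le {n : ℕ} (hn : 0 < n) {r d : ℝ} (hr : 0 < r) (hd : 0 ≤ d) :
    ∑' l : ℕ, (if d < 2 * (2 ^ l * r) then ENNReal.ofReal ((d / (2 ^ l * r)) ^ n) else 0) ≤
      2 ^ (n + 1) := by
  refine ENNReal.tsum_le_of_sum_range_le fun N => ?_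
  have h0 : ∀ l : ℕ, d / (2 * r) / 2 ^ l = d / (2 * (2 ^ l * r)) := fun l => by field_simp
  calc _ ≤ ∑ l ∈ Finset.range N, ENNReal.ofReal (2 ^ n *
        (if d / (2 * r) / 2 ^ l < 1 then d / (2 * r) / 2 ^ l else 0)) := by
        refine Finset.sum_le_sum fun l _ => ?_
        have hp : 0 < 2 * (2 ^ l * r) := by positivity
        simp only [h0, div_lt_one hp]
        split_ifs with h
        · refine ENNReal.ofReal_le_ofReal ?_
          have h3 : d / (2 ^ l * r) = 2 * (d / (2 * (2 ^ l * r))) := by field_simp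
          rw [h3, mul_pow]
          gcongr
          exact pow_le_of_le_one (by positivity) ((div_le_one hp).2 h.le) hn.ne'
        · simp
    _ = ENNReal.ofReal (2 ^ n * ∑ l ∈ Finset.range N,
        (if d / (2 * r) / 2 ^ l < 1 then d / (2 * r) / 2 ^ l else 0)) := by
        rw [Finset.mul_sum, ENNReal.ofReal_sum_of_nonneg]
        intro l _
        split_ifs <;> positivity
    _ ≤ ENNReal.ofReal (2 ^ n * 2) := by
        gcongr
        exact (sum_range_dyadic_truncation_le N (by positivity)).trans (min_le_left _ _)
    _ = 2 ^ (n + 1) := by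
        rw [← pow_succ, ENNReal.ofReal_pow (by norm_num)]
        simp

/-- The length of the difference `w y - w z`. -/
noncomputable def diffLen {n : ℕ} {ι : Type} [Fintype ι] (w : Euc n → ι → ℝ) (y z : Euc n) : ℝ :=
  Real.sqrt (∑ i, (w y i - w z i) ^ 2)

/-- The integrand of the functional `Jfun`. -/
noncomputable def fracIntegrand {n : ℕ} (σ : ℝ) (A : ℝ → ℝ≥0∞) {ι : Type} [Fintype ι]
    (w : Euc n → ι → ℝ) (y z : Euc n) : ℝ≥0∞ :=
  A (diffLen w y z / ‖y - z‖ ^ σ) / ENNReal.ofReal (‖y - z‖ ^ (n : ℝ))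

section

variable {n : ℕ} {ι : Type} [Fintype ι]

lemma abs_sub_le_mul_diffLen (v : Euc n → ι → ℝ) {lam : ℝ} (hlam : 0 < lam) (i : ι)
    (y z : Euc n) : |v y i - v z i| ≤ lam * diffLen (fun x i => v x i / lam) y z := by
  have h1 : |v y i - v z i| = lam * |v y i / lam - v z i / lam| := by
    rw [← sub_div, abs_div, abs_of_pos hlam]; field_simp
  rw [h1]
  gcongr
  refine Real.abs_le_sqrt ?_
  exact Finset.single_le_sum (f := fun i => (v y i / lam - v z i / lam) ^ 2)
    (fun _ _ => sq_nonneg _) (Finset.mem_univ i)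

lemma ofReal_diffLen_le {σ : ℝ} (hσ : 0 ≤ σ) (A : ℝ → ℝ≥0∞) (w : Euc n → ι → ℝ) {τ R : ℝ}
    (hτ : 0 < τ) {y z : Euc n} (hyz : ‖y - z‖ < 2 * R) :
    ENNReal.ofReal (diffLen w y z) ≤ ENNReal.ofReal ((2 * R) ^ σ / τ) *
      (ENNReal.ofReal ‖y - z‖ ^ n * fracIntegrand σ A w y z + youngConj A τ) := by
  rcases eq_or_ne y z with rfl | hne
  · simp [diffLen]
  have hd : 0 < ‖y - z‖ := norm_pos_iff.2 (sub_ne_zero.2 hne)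
  have hR : 0 < R := by linarith
  set W := diffLen w y z with hW
  have hW0 : 0 ≤ W := Real.sqrt_nonneg _
  have hmul : ENNReal.ofReal ‖y - z‖ ^ n * fracIntegrand σ A w y z = A (W / ‖y - z‖ ^ σ) := by
    unfold fracIntegrand
    rw [Real.rpow_natCast, ENNReal.ofReal_pow hd.le]
    refine ENNReal.mul_div_cancel ?_ (by finiteness)
    exact pow_ne_zero _ (by simpa using hne |> sub_ne_zero.2)
  rw [hmul]
  have hy := ofReal_mul_le_add_youngConj A τ (a := W / ‖y - z‖ ^ σ) (by positivity)
  calc ENNReal.ofReal W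
      ≤ ENNReal.ofReal ((2 * R) ^ σ / τ * (W / ‖y - z‖ ^ σ * τ)) := by
        refine ENNReal.ofReal_le_ofReal ?_
        have h1 : ‖y - z‖ ^ σ ≤ (2 * R) ^ σ := Real.rpow_le_rpow hd.le hyz.le hσ
        have h2 : 0 < ‖y - z‖ ^ σ := by positivity
        have h3 : (2 * R) ^ σ / τ * (W / ‖y - z‖ ^ σ * τ) = W * ((2 * R) ^ σ / ‖y - z‖ ^ σ) := by
          field_simp
        rw [h3]
        exact le_mul_of_one_le_right hW0 ((one_le_div h2).2 h1)
    _ = ENNReal.ofReal ((2 * R) ^ σ / τ) * ENNReal.ofReal (W / ‖y - z‖ ^ σ * τ) :=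
        ENNReal.ofReal_mul (by positivity)
    _ ≤ _ := by gcongr

lemma ballOsc_le_fracIntegrand {σ : ℝ} (hσ : 0 ≤ σ) (A : ℝ → ℝ≥0∞) (v : Euc n → ι → ℝ)
    {lam : ℝ} (hlam : 0 < lam) (i : ι) {τ R : ℝ} (hτ : 0 < τ) (hR : 0 < R) (x : Euc n) :
    ballOsc (fun y => v y i) x R ≤ ENNReal.ofReal (lam * ((2 * R) ^ σ / τ)) *
      ((volume (ball x R))⁻¹ ^ 2 * (∫⁻ y in ball x R, ∫⁻ z in ball x R,
        ENNReal.ofReal ‖y - z‖ ^ n * fracIntegrand σ A (fun x i => v x i / lam) y z) +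
          youngConj A τ) := by
  set w : Euc n → ι → ℝ := fun x i => v x i / lam with hw
  set V := volume (ball x R) with hV
  have hV0 : V ≠ 0 := volume_ball_ne_zero x hR
  have hVt : V ≠ ⊤ := volume_ball_ne_top x R
  set K := ENNReal.ofReal (lam * ((2 * R) ^ σ / τ)) with hK
  set I := ∫⁻ y in ball x R, ∫⁻ z in ball x R,
        ENNReal.ofReal ‖y - z‖ ^ n * fracIntegrand σ A w y z with hI
  have h1 : ∫⁻ y in ball x R, ∫⁻ z in ball x R, ‖v y i - v z i‖ₑ ≤
      K * (I + V ^ 2 * youngConj A τ) := by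
    calc ∫⁻ y in ball x R, ∫⁻ z in ball x R, ‖v y i - v z i‖ₑ
        ≤ ∫⁻ y in ball x R, ∫⁻ z in ball x R,
            K * (ENNReal.ofReal ‖y - z‖ ^ n * fracIntegrand σ A w y z + youngConj A τ) := by
          refine setLIntegral_mono' measurableSet_ball fun y hy =>
            setLIntegral_mono' measurableSet_ball fun z hz => ?_
          have hyz : ‖y - z‖ < 2 * R := by
            rw [← dist_eq_norm]
            have := dist_triangle_right y z x
            rw [mem_ball] at hy hz
            linarith
          calc ‖v y i - v z i‖ₑ = ENNReal.ofReal |v y i - v z i| := by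
                rw [← Real.norm_eq_abs, ofReal_norm]
            _ ≤ ENNReal.ofReal (lam * diffLen w y z) :=
                ENNReal.ofReal_le_ofReal (abs_sub_le_mul_diffLen v hlam i y z)
            _ = ENNReal.ofReal lam * ENNReal.ofReal (diffLen w y z) :=
                ENNReal.ofReal_mul hlam.le
            _ ≤ ENNReal.ofReal lam * (ENNReal.ofReal ((2 * R) ^ σ / τ) *
                (ENNReal.ofReal ‖y - z‖ ^ n * fracIntegrand σ A w y z + youngConj A τ)) := by
                gcongr
                exact ofReal_diffLen_le hσ A w hτ hyz
            _ = _ := by rw [hK, ENNReal.ofReal_mul hlam.le, mul_assoc]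
      _ = K * (I + V ^ 2 * youngConj A τ) := by
          simp only [lintegral_const_mul' K _ ENNReal.ofReal_ne_top]
          simp only [lintegral_add_right _ measurable_const, setLIntegral_const]
          rw [hI, ← hV]
          ring
  calc ballOsc (fun y => v y i) x R
      ≤ V⁻¹ * (V⁻¹ * (K * (I + V ^ 2 * youngConj A τ))) := by
        unfold ballOsc
        gcongr
    _ = K * (V⁻¹ ^ 2 * I + (V⁻¹ * V) ^ 2 * youngConj A τ) := by ring
    _ = _ := by rw [ENNReal.inv_mul_cancel hV0 hVt, one_pow, one_mul]

lemma tsum_lintegral_ball_fracIntegrand_le (hn : 0 < n) (G : Euc n → Euc n → ℝ≥0∞)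
    {r : ℝ} (hr : 0 < r) (x : Euc n) :
    ∑' l : ℕ, (ENNReal.ofReal (2 ^ l * r) ^ n)⁻¹ *
      ∫⁻ y in ball x (2 ^ l * r), ∫⁻ z in ball x (2 ^ l * r),
        ENNReal.ofReal ‖y - z‖ ^ n * G y z ≤ 2 ^ (n + 1) * ∫⁻ y, ∫⁻ z, G y z := by
  set q : ℕ → ℝ → ℝ≥0∞ := fun l d =>
    if d < 2 * (2 ^ l * r) then ENNReal.ofReal ((d / (2 ^ l * r)) ^ n) else 0 with hq
  have h1 : ∀ l : ℕ, (ENNReal.ofReal (2 ^ l * r) ^ n)⁻¹ *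
      ∫⁻ y in ball x (2 ^ l * r), ∫⁻ z in ball x (2 ^ l * r),
        ENNReal.ofReal ‖y - z‖ ^ n * G y z ≤ ∫⁻ y, ∫⁻ z, q l ‖y - z‖ * G y z := by
    intro l
    have hR : 0 < 2 ^ l * r := by positivity
    have hne : (ENNReal.ofReal (2 ^ l * r) ^ n)⁻¹ ≠ ⊤ :=
      ENNReal.inv_ne_top.2 (pow_ne_zero _ (by simpa using hr))
    simp only [← lintegral_const_mul' _ _ hne]
    calc _ ≤ ∫⁻ y in ball x (2 ^ l * r), ∫⁻ z in ball x (2 ^ l * r), q l ‖y - z‖ * G y z := by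
          refine setLIntegral_mono' measurableSet_ball fun y hy =>
            setLIntegral_mono' measurableSet_ball fun z hz => ?_
          have hyz : ‖y - z‖ < 2 * (2 ^ l * r) := by
            rw [← dist_eq_norm]
            have := dist_triangle_right y z x
            rw [mem_ball] at hy hz
            linarith
          rw [← mul_assoc]
          refine mul_le_mul_left (le_of_eq ?_) _
          simp only [hq, if_pos hyz]
          rw [ENNReal.ofReal_pow (by positivity), ENNReal.ofReal_div_of_pos hR,
            ENNReal.div_eq_inv_mul, mul_pow, ENNReal.inv_pow]
      _ ≤ ∫⁻ y in ball x (2 ^ l * r), ∫⁻ z, q l ‖y - z‖ * G y z :=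
          lintegral_mono fun y => setLIntegral_le_lintegral _ _
      _ ≤ _ := setLIntegral_le_lintegral _ _
  refine (ENNReal.tsum_le_tsum h1).trans ((tsum_lintegral_le_lintegral_tsum _ _).trans ?_)
  rw [← lintegral_const_mul' _ _ (by finiteness)]
  refine lintegral_mono fun y => (tsum_lintegral_le_lintegral_tsum _ _).trans ?_
  rw [← lintegral_const_mul' _ _ (by finiteness)]
  refine lintegral_mono fun z => ?_
  rw [ENNReal.tsum_mul_right]
  gcongr
  exact tsum_dyadic_truncation_le hn hr (norm_nonneg _)

end

lemma dyadic_scaling_identity {n j : ℕ} {σ β t r : ℝ} (ht : 0 < t) (hr : 0 < r)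
    (hsum : (n : ℝ) = j + σ + β) (l : ℕ) :
    (2 ^ l * r) ^ j * ((2 * (2 ^ l * r)) ^ σ / (t * (2 : ℝ) ^ (-((l + 1 : ℕ) * β)))) =
      2 ^ (σ + β) / (t * r ^ β) * (2 ^ l * r) ^ n := by
  have hR : 0 < 2 ^ l * r := by positivity
  have h1 : (2 ^ l * r) ^ n = (2 ^ l * r) ^ j * (2 ^ l * r) ^ σ * ((2 : ℝ) ^ (l * β) * r ^ β) := by
    have h2 : (2 : ℝ) ^ (l * β) * r ^ β = (2 ^ l * r) ^ β := by
      rw [Real.mul_rpow (by positivity) hr.le, Real.rpow_mul (by norm_num), Real.rpow_natCast]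
    rw [h2, ← Real.rpow_natCast _ n, ← Real.rpow_natCast _ j, ← Real.rpow_add hR,
      ← Real.rpow_add hR, hsum]
  have h3 : (2 : ℝ) ^ (-((l + 1 : ℕ) * β)) = ((2 : ℝ) ^ (l * β) * 2 ^ β)⁻¹ := by
    rw [Real.rpow_neg (by norm_num), ← Real.rpow_add (by norm_num)]
    congr 2; push_cast; ring
  rw [h1, h3, Real.mul_rpow (by norm_num) hR.le, Real.rpow_add (by norm_num)]
  field_simp

lemma tsum_gradOsc_le {n m j : ℕ} (hn : 0 < n) (D : (h : ℕ) → Euc n → (Fin h → Fin n) → ℝ)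
    {σ β : ℝ} (hσ : 0 ≤ σ) (hsum : (n : ℝ) = j + σ + β) (A : ℝ → ℝ≥0∞) {lam t r : ℝ}
    (hlam : 0 < lam) (ht : 0 < t) (hr : 0 < r)
    (hJ : Jfun n σ A (fun x i => D m x i / lam) ≤ 1) (x : Euc n) :
    ∑' l : ℕ, ENNReal.ofReal (2 ^ l * r) ^ j * gradOsc D m x (2 ^ l * r) ≤
      n ^ m * ENNReal.ofReal (lam * (2 ^ (σ + β) / (t * r ^ β))) *
        ((volume (ball (0 : Euc n) 1))⁻¹ ^ 2 * 2 ^ (n + 1) + ENNReal.ofReal r ^ n *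
          ∑' l : ℕ, 2 ^ (l * n) * youngConj A (t * (2 : ℝ) ^ (-((l + 1 : ℕ) * β)))) := by
  set ω := volume (ball (0 : Euc n) 1) with hω
  have hω0 : ω ≠ 0 := volume_ball_ne_zero 0 one_pos
  have hωt : ω ≠ ⊤ := volume_ball_ne_top 0 1
  set w : Euc n → (Fin m → Fin n) → ℝ := fun x i => D m x i / lam with hw
  set I : ℕ → ℝ≥0∞ := fun l => ∫⁻ y in ball x (2 ^ l * r), ∫⁻ z in ball x (2 ^ l * r),
    ENNReal.ofReal ‖y - z‖ ^ n * fracIntegrand σ A w y z with hI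
  set a : ℕ → ℝ≥0∞ := fun l => youngConj A (t * (2 : ℝ) ^ (-((l + 1 : ℕ) * β))) with ha
  set K := ENNReal.ofReal (lam * (2 ^ (σ + β) / (t * r ^ β))) with hK
  have step : ∀ l : ℕ, ENNReal.ofReal (2 ^ l * r) ^ j * gradOsc D m x (2 ^ l * r) ≤
      n ^ m * K * (ω⁻¹ ^ 2 * ((ENNReal.ofReal (2 ^ l * r) ^ n)⁻¹ * I l) +
        ENNReal.ofReal r ^ n * (2 ^ (l * n) * a l)) := by
    intro l
    have hR : 0 < 2 ^ l * r := by positivity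
    set R := 2 ^ l * r with hRdef
    have hτ : 0 < t * (2 : ℝ) ^ (-((l + 1 : ℕ) * β)) := by positivity
    set ρ := ENNReal.ofReal R ^ n with hρ
    have hρ0 : ρ ≠ 0 := pow_ne_zero _ (by simpa using hR)
    have hρt : ρ ≠ ⊤ := by finiteness
    have hV : (volume (ball x R))⁻¹ = ρ⁻¹ * ω⁻¹ := by
      rw [volume_ball_euc hn x hR.le, ENNReal.mul_inv (.inl hρ0) (.inl hρt)]
    have hsc : ENNReal.ofReal R ^ j * ENNReal.ofReal
        (lam * ((2 * R) ^ σ / (t * (2 : ℝ) ^ (-((l + 1 : ℕ) * β))))) = K * ρ := by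
      rw [hK, hρ, ← ENNReal.ofReal_pow hR.le, ← ENNReal.ofReal_pow hR.le,
        ← ENNReal.ofReal_mul (by positivity), ← ENNReal.ofReal_mul (by positivity),
        mul_left_comm, dyadic_scaling_identity ht hr hsum, mul_assoc]
    have hρ2 : ρ = ENNReal.ofReal r ^ n * 2 ^ (l * n) := by
      rw [hρ, hRdef, ENNReal.ofReal_mul (by positivity), ENNReal.ofReal_pow (by norm_num),
        mul_pow, pow_mul, mul_comm]
      simp
    have h1 : gradOsc D m x R ≤ n ^ m * (ENNReal.ofReal
        (lam * ((2 * R) ^ σ / (t * (2 : ℝ) ^ (-((l + 1 : ℕ) * β))))) *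
          ((volume (ball x R))⁻¹ ^ 2 * I l + a l)) := by
      unfold gradOsc
      refine (Finset.sum_le_card_nsmul _ _ _ fun d _ =>
        ballOsc_le_fracIntegrand hσ A (fun y i => D m y i) hlam d hτ hR x).trans_eq ?_
      simp [hI, ha, hw, hRdef]
    calc _ ≤ ENNReal.ofReal R ^ j * _ := mul_le_mul_right h1 _
      _ = n ^ m * (ENNReal.ofReal R ^ j * ENNReal.ofReal
        (lam * ((2 * R) ^ σ / (t * (2 : ℝ) ^ (-((l + 1 : ℕ) * β)))))) *
          ((volume (ball x R))⁻¹ ^ 2 * I l + a l) := by ring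
      _ = n ^ m * K * (ω⁻¹ ^ 2 * (ρ * ρ⁻¹ * (ρ⁻¹ * I l)) + ρ * a l) := by rw [hsc, hV]; ring
      _ = _ := by rw [ENNReal.mul_inv_cancel hρ0 hρt, one_mul]; nth_rewrite 2 [hρ2]; ring
  have hsumI := tsum_lintegral_ball_fracIntegrand_le hn (fracIntegrand σ A w) hr x
  have hJ' : ∫⁻ y, ∫⁻ z, fracIntegrand σ A w y z ≤ 1 := hJ
  calc _ ≤ ∑' l : ℕ, n ^ m * K * (ω⁻¹ ^ 2 * ((ENNReal.ofReal (2 ^ l * r) ^ n)⁻¹ * I l) +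
        ENNReal.ofReal r ^ n * (2 ^ (l * n) * a l)) := ENNReal.tsum_le_tsum step
    _ = n ^ m * K * (ω⁻¹ ^ 2 * (∑' l : ℕ, (ENNReal.ofReal (2 ^ l * r) ^ n)⁻¹ * I l) +
        ENNReal.ofReal r ^ n * ∑' l : ℕ, 2 ^ (l * n) * a l) := by
        rw [ENNReal.tsum_mul_left, ENNReal.tsum_add, ENNReal.tsum_mul_left, ENNReal.tsum_mul_left]
    _ ≤ _ := by
        gcongr
        refine hsumI.trans ?_
        calc (2 : ℝ≥0∞) ^ (n + 1) * _ ≤ 2 ^ (n + 1) * 1 := by gcongr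
          _ = _ := mul_one _

/-- The dimensional constant in the estimate of the mean deviation from the projection
polynomial. -/
noncomputable def deviationConst (n m k j : ℕ) (β : ℝ) : ℝ≥0∞ :=
  (2 ^ (n + 2)) ^ (k + 1) * ((2 ^ n + 2) ^ (j + 1) * (2 ^ (n + 3)) ^ j) * n ^ m *
    ((volume (ball (0 : Euc n) 1))⁻¹ ^ 2 * 2 ^ (n + 1) +
      (ENNReal.ofReal (1 - 2 ^ (-β)))⁻¹ * (volume (ball (0 : Euc n) 1))⁻¹)

lemma one_sub_two_rpow_neg_pos {β : ℝ} (hβ : 0 < β) : 0 < 1 - (2 : ℝ) ^ (-β) := by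
  have : (2 : ℝ) ^ (-β) < 1 := Real.rpow_lt_one_of_one_lt_of_neg (by norm_num) (by linarith)
  linarith

lemma deviationConst_ne_top (n m k j : ℕ) {β : ℝ} (hβ : 0 < β) :
    deviationConst n m k j β ≠ ⊤ := by
  have h1 : (volume (ball (0 : Euc n) 1))⁻¹ ≠ ⊤ :=
    ENNReal.inv_ne_top.2 (volume_ball_ne_zero 0 one_pos)
  have h2 : (ENNReal.ofReal (1 - 2 ^ (-β)))⁻¹ ≠ ⊤ :=
    ENNReal.inv_ne_top.2 (by simpa using one_sub_two_rpow_neg_pos hβ)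
  unfold deviationConst
  finiteness

lemma HasWeakDerivs.ballAvg_sub_polyFun_le_of_Fk_le {n m k j : ℕ} (hn : 0 < n) {u : Euc n → ℝ}
    {D : (h : ℕ) → Euc n → (Fin h → Fin n) → ℝ} (hu : HasWeakDerivs n m u D)
    (hd : DecayFrom n (k + 1) m D) (hkj : k + 1 + j = m) {s σ β : ℝ} (hσ : 0 ≤ σ)
    (hs : s = m + σ) (hβ : β = n - s + k + 1) (hβ0 : 0 < β) (A : ℝ → ℝ≥0∞) {lam t r : ℝ}
    (hlam : 0 < lam) (ht : 0 < t) (hr : 0 < r)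
    (hJ : Jfun n σ A (fun x i => D m x i / lam) ≤ 1) {x : Euc n}
    (hF : Fk n s k A t ≤ (volume (ball x r))⁻¹) {P : MvPolynomial (Fin n) ℝ}
    (hP : IsCampPoly n k D (ball x r) P)
    (hP0 : ∀ x dirs, partialDeriv (polyFun P) (k + 1) x dirs = 0) :
    ballAvg (fun x => u x - polyFun P x) x r ≤ deviationConst n m k j β *
      ENNReal.ofReal (r ^ (k + 1) * (lam * (2 ^ (σ + β) / (t * r ^ β)))) := by
  set ω := volume (ball (0 : Euc n) 1) with hω
  set S := ∑' l : ℕ, 2 ^ (l * n) * youngConj A (t * (2 : ℝ) ^ (-((l + 1 : ℕ) * β))) with hS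
  set K := ENNReal.ofReal (lam * (2 ^ (σ + β) / (t * r ^ β))) with hK
  have hsum : (n : ℝ) = j + σ + β := by
    rw [hβ, hs, ← hkj]; push_cast; ring
  set q := ENNReal.ofReal (1 - 2 ^ (-β)) with hq
  have hq0 : q ≠ 0 := by simpa [hq] using one_sub_two_rpow_neg_pos hβ0
  have hρ0 : ENNReal.ofReal r ^ n ≠ 0 := pow_ne_zero _ (by simpa using hr)
  have hρt : ENNReal.ofReal r ^ n ≠ ⊤ := by finiteness
  have hS' : ENNReal.ofReal r ^ n * S ≤ q⁻¹ * ω⁻¹ := by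
    have h1 : q * S ≤ (ENNReal.ofReal r ^ n)⁻¹ * ω⁻¹ := by
      rw [← ENNReal.mul_inv (.inl hρ0) (.inl hρt), ← volume_ball_euc hn x hr.le]
      exact (tsum_youngConj_le_Fk A hβ hβ0 ht).trans hF
    calc ENNReal.ofReal r ^ n * S = ENNReal.ofReal r ^ n * (q⁻¹ * q) * S := by
          rw [ENNReal.inv_mul_cancel hq0 ENNReal.ofReal_ne_top, mul_one]
      _ = ENNReal.ofReal r ^ n * q⁻¹ * (q * S) := by ring
      _ ≤ ENNReal.ofReal r ^ n * q⁻¹ * ((ENNReal.ofReal r ^ n)⁻¹ * ω⁻¹) := by gcongr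
      _ = ENNReal.ofReal r ^ n * (ENNReal.ofReal r ^ n)⁻¹ * (q⁻¹ * ω⁻¹) := by ring
      _ = q⁻¹ * ω⁻¹ := by rw [ENNReal.mul_inv_cancel hρ0 hρt, one_mul]
  calc ballAvg (fun x => u x - polyFun P x) x r
      ≤ (2 ^ (n + 2) * ENNReal.ofReal r) ^ (k + 1) * gradAvg D (k + 1) x r :=
        hu.ballAvg_sub_polyFun_le (by lia) hr hP hP0
    _ ≤ (2 ^ (n + 2) * ENNReal.ofReal r) ^ (k + 1) *
          (((2 ^ n + 2) ^ (j + 1) * (2 ^ (n + 3)) ^ j) *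
            (n ^ m * K * (ω⁻¹ ^ 2 * 2 ^ (n + 1) + q⁻¹ * ω⁻¹))) := by
        gcongr
        refine (hu.gradAvg_le_tsum_pow hn hd j le_rfl hkj x hr).trans ?_
        gcongr
        refine (tsum_gradOsc_le hn D hσ hsum A hlam ht hr hJ x).trans ?_
        gcongr
    _ = _ := by
        rw [ENNReal.ofReal_mul (by positivity), ENNReal.ofReal_pow hr.le, ← hK, mul_pow]
        unfold deviationConst
        ring

lemma ofReal_average_abs_le_ballAvg {n : ℕ} (f : Euc n → ℝ) (x : Euc n) (r : ℝ) :
    ENNReal.ofReal (⨍ y in ball x r, |f y|) ≤ ballAvg f x r := by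
  rw [setAverage_eq, smul_eq_mul, ENNReal.ofReal_mul (by positivity)]
  unfold ballAvg
  refine mul_le_mul' ?_ ?_
  · rcases eq_or_ne (volume (ball x r)) 0 with h | h
    · simp [h]
    · rw [Measure.real, ENNReal.ofReal_inv_of_pos
        (ENNReal.toReal_pos h (volume_ball_ne_top x r)),
        ENNReal.ofReal_toReal (volume_ball_ne_top x r)]
  · calc _ = ‖∫ y in ball x r, |f y|‖ₑ :=
          (Real.enorm_of_nonneg (integral_nonneg fun _ => abs_nonneg _)).symm
      _ ≤ ∫⁻ y in ball x r, ‖|f y|‖ₑ := enorm_integral_le_lintegral_enorm _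
      _ = _ := by simp

lemma rcInv_nonneg (A : ℝ → ℝ≥0∞) (v : ℝ≥0∞) : 0 ≤ rcInv A v :=
  Real.sInf_nonneg fun _ h => h.1

lemma apply_le_of_lt_rcInv {A : ℝ → ℝ≥0∞} {v : ℝ≥0∞} {t : ℝ} (ht : 0 ≤ t) (h : t < rcInv A v) :
    A t ≤ v := by
  by_contra! hc
  exact notMem_of_lt_csInf h ⟨0, fun _ h => h.1⟩ ⟨ht, hc⟩

lemma HasWeakDerivs.oscQuotK_le {n m k j : ℕ} (hn : 0 < n) {u : Euc n → ℝ}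
    {D : (h : ℕ) → Euc n → (Fin h → Fin n) → ℝ} (hu : HasWeakDerivs n m u D)
    (hd : DecayFrom n (k + 1) m D) (hkj : k + 1 + j = m) {s σ β : ℝ} (hσ : 0 ≤ σ)
    (hs : s = m + σ) (hβ : β = n - s + k + 1) (hβ0 : 0 < β) (A : ℝ → ℝ≥0∞) {lam r : ℝ}
    (hlam : 0 < lam) (hr : 0 < r)
    (hJ : Jfun n σ A (fun x i => D m x i / lam) ≤ 1) (x : Euc n) :
    oscQuotK n k (psiK n s k A) u D x r ≤ deviationConst n m k j β *
      ENNReal.ofReal (((volume (ball (0 : Euc n) 1)).toReal ^ ((n : ℝ)⁻¹)) ^ ((n : ℝ) - s) *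
        (2 * 2 ^ (σ + β))) * ENNReal.ofReal lam := by
  obtain ⟨P, hP, hP0⟩ := hu.exists_isCampPoly (k := k) (by lia) x hr
  refine (iInf₂_le P hP).trans ?_
  have hV0 := volume_ball_ne_zero x hr
  have hVt := volume_ball_ne_top x r
  set κ := (volume (ball (0 : Euc n) 1)).toReal ^ ((n : ℝ)⁻¹) with hκ
  set V := (volume (ball x r)).toReal with hV
  have hVpos : 0 < V := ENNReal.toReal_pos hV0 hVt
  have hn' : (n : ℝ) ≠ 0 := by positivity
  have hκ0 : 0 < κ := Real.rpow_pos_of_pos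
    (ENNReal.toReal_pos (volume_ball_ne_zero 0 one_pos) (volume_ball_ne_top 0 1)) _
  have hrad : V ^ ((n : ℝ)⁻¹) = κ * r := by
    rw [hV, volume_ball_euc hn x hr.le, ENNReal.toReal_mul, ENNReal.toReal_pow,
      ENNReal.toReal_ofReal hr.le, Real.mul_rpow (by positivity) (by positivity),
      Real.pow_rpow_inv_natCast hr.le hn.ne', mul_comm]
  set Λ := rcInv (Fk n s k A) (ENNReal.ofReal ((κ * r) ^ (-(n : ℝ)))) with hΛ
  have hκr : 0 < κ * r := by positivity
  have hcoef : (psiK n s k A (V ^ ((n : ℝ)⁻¹)) * V ^ ((k : ℝ) / n))⁻¹ =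
      (κ * r) ^ ((n : ℝ) - s) * Λ := by
    have h1 : V ^ ((k : ℝ) / n) = (κ * r) ^ (k : ℝ) := by
      rw [← hrad, ← Real.rpow_mul hVpos.le]; congr 1; field_simp
    unfold psiK
    rw [hrad, h1, ← hΛ, mul_inv, inv_inv, Real.rpow_add hκr]
    field_simp
  rw [hcoef]
  have hΛ0 : 0 ≤ Λ := rcInv_nonneg _ _
  rcases hΛ0.eq_or_lt with h0 | hΛpos
  · simp [← h0]
  have hF : Fk n s k A (Λ / 2) ≤ (volume (ball x r))⁻¹ := by
    refine (apply_le_of_lt_rcInv (by positivity) (half_lt_self hΛpos)).trans_eq ?_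
    rw [← hrad, ← Real.rpow_mul hVpos.le, mul_neg, inv_mul_cancel₀ hn', Real.rpow_neg_one,
      ENNReal.ofReal_inv_of_pos hVpos, hV, ENNReal.ofReal_toReal hVt]
  have hmain := hu.ballAvg_sub_polyFun_le_of_Fk_le hn hd hkj hσ hs hβ hβ0 A hlam
    (half_pos hΛpos) hr hJ hF hP hP0
  rw [ENNReal.ofReal_mul (by positivity)]
  refine (mul_le_mul_right ((ofReal_average_abs_le_ballAvg
    (fun y => u y - polyFun P y) x r).trans hmain) _).trans_eq ?_
  rw [mul_left_comm, ← ENNReal.ofReal_mul (by positivity),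
    mul_assoc (deviationConst n m k j β),
    ← ENNReal.ofReal_mul (by positivity)]
  congr 2
  have h2 : r ^ β = r ^ ((n : ℝ) - s) * r ^ (k + 1) := by
    rw [← Real.rpow_natCast, ← Real.rpow_add hr, hβ]; congr 1; push_cast; ring
  rw [h2, Real.mul_rpow hκ0.le hr.le]
  field_simp

/-- Optimal embedding of `V^{s,A}_{d,k+1}(ℝⁿ)` into the `k`-th order
Campanato space `𝓛^{k,ψ^k_{s,A}}(ℝⁿ)`. -/
theorem stmt12 (n : ℕ) (hn : 0 < n) (s : ℝ) (hs1 : 1 < s) (hs2 : ∀ m : ℕ, s ≠ (m : ℝ))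
    (k : ℕ) (hk : k < ⌊s⌋₊) (hsk : s < (n : ℝ) + (k : ℝ) + 1) :
    ∃ c : ℝ, 0 < c ∧ ∀ A : ℝ → ℝ≥0∞, IsYoung A → IntCondK n s k A →
      ∀ (u : Euc n → ℝ) (D : (h : ℕ) → Euc n → (Fin h → Fin n) → ℝ),
        HasWeakDerivs n ⌊s⌋₊ u D → DecayFrom n (k + 1) ⌊s⌋₊ D →
        fracSem n (s - (⌊s⌋₊ : ℝ)) A (D ⌊s⌋₊) < ⊤ →
        campSemK n k (psiK n s k A) u D ≤
          ENNReal.ofReal c * fracSem n (s - (⌊s⌋₊ : ℝ)) A (D ⌊s⌋₊) := by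
  set m := ⌊s⌋₊ with hm
  have hms : (m : ℝ) ≤ s := Nat.floor_le (by linarith)
  obtain ⟨j, hj⟩ : ∃ j, k + 1 + j = m := ⟨m - (k + 1), by lia⟩
  set β : ℝ := n - s + k + 1 with hβ
  have hβ0 : 0 < β := by linarith
  set M : ℝ≥0∞ := deviationConst n m k j β * ENNReal.ofReal
    (((volume (ball (0 : Euc n) 1)).toReal ^ ((n : ℝ)⁻¹)) ^ ((n : ℝ) - s) *
      (2 * 2 ^ (s - m + β))) with hM
  have hMt : M ≠ ⊤ := ENNReal.mul_ne_top (deviationConst_ne_top n m k j hβ0)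
    ENNReal.ofReal_ne_top
  have hc : 0 < M.toReal + 1 := by positivity
  refine ⟨M.toReal + 1, hc, fun A _ _ u D hu hd _ => ?_⟩
  have hMc : M ≤ ENNReal.ofReal (M.toReal + 1) :=
    (ENNReal.ofReal_toReal hMt).ge.trans (ENNReal.ofReal_le_ofReal (by linarith))
  refine iSup_le fun x => iSup₂_le fun r hr => ?_
  rw [mul_comm, ← ENNReal.div_le_iff (by simpa using hc) ENNReal.ofReal_ne_top]
  refine le_sInf ?_
  rintro _ ⟨lam, ⟨hlam, hJ⟩, rfl⟩
  rw [ENNReal.div_le_iff (by simpa using hc) ENNReal.ofReal_ne_top, mul_comm]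
  exact (hu.oscQuotK_le hn hd hj (sub_nonneg.2 hms) (by ring) hβ hβ0 A hlam hr hJ x).trans
    (mul_le_mul_left hMc _)
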